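/- arXiv:1606.02994 — 3 statements merged into one kernel-verified Lean document; each statement's English description precedes it below -/
import Mathlib

section
/- Let ρ>1 and let T:ℝ→ℝ be a nondecreasing function that is locally integrable enough for the following integral to make sense. Define ψ(x)=ρ∫₀ˣ |T(x')−x'|^{ρ−2}(T(x')−x') dx'. Then for all x,z∈ℝ one has ψ(x)−ψ(z) ≤ |T(x)−z|^ρ − |T(x)−x|^ρ, and consequently, for every x∈ℝ, ψ(x)+|T(x)−x|^ρ = inf_{z∈ℝ} { ψ(z)+|T(x)−z|^ρ }. -/
open MeasureTheory intervalIntegral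

/-- The function `r ↦ r |r|^(ρ-2)`, i.e. `(1/ρ)` times the derivative of `|r|^ρ`, is
nondecreasing. -/
theorem monotone_abs_rpow_sub_two_mul_self {ρ : ℝ} (hρ : 1 < ρ) :
    Monotone fun r : ℝ => |r| ^ (ρ - 2) * r := by
  have key : ∀ r : ℝ, 0 ≤ r → |r| ^ (ρ - 2) * r = r ^ (ρ - 1) := by
    intro r hr
    rcases hr.eq_or_lt with rfl | hr
    · rw [mul_zero, Real.zero_rpow (by linarith)]
    · rw [abs_of_pos hr, ← Real.rpow_add_one hr.ne']
      ring_nf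
  have mono_of_nonneg : ∀ r s : ℝ, 0 ≤ r → r ≤ s →
      |r| ^ (ρ - 2) * r ≤ |s| ^ (ρ - 2) * s := by
    intro r s hr hrs
    rw [key r hr, key s (hr.trans hrs)]
    exact Real.rpow_le_rpow hr hrs (by linarith)
  intro r s hrs
  rcases le_total 0 r with hr | hr
  · exact mono_of_nonneg r s hr hrs
  rcases le_total 0 s with hs | hs
  · exact (mul_nonpos_of_nonneg_of_nonpos (by positivity) hr).trans (by positivity)
  · have h := mono_of_nonneg (-s) (-r) (by linarith) (by linarith)
    simp only [abs_neg] at h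
    simp only
    linarith

/-- The fundamental theorem of calculus for `x ↦ |t - x|^ρ`. -/
theorem integral_abs_sub_rpow_sub_two_mul {ρ : ℝ} (hρ : 1 < ρ) (t a b : ℝ) :
    IntervalIntegrable (fun y => |t - y| ^ (ρ - 2) * (t - y)) volume a b ∧
      ρ * ∫ y in a..b, |t - y| ^ (ρ - 2) * (t - y) = |t - a| ^ ρ - |t - b| ^ ρ := by
  have hanti : Antitone fun y : ℝ => |t - y| ^ (ρ - 2) * (t - y) := fun u v huv =>
    monotone_abs_rpow_sub_two_mul_self hρ (sub_le_sub_left huv t)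
  have hi := hanti.intervalIntegrable (μ := volume) (a := a) (b := b)
  refine ⟨hi, ?_⟩
  have hderiv : ∀ y ∈ Set.uIcc a b, HasDerivAt (fun y => -|t - y| ^ ρ)
      (ρ * (|t - y| ^ (ρ - 2) * (t - y))) y := by
    intro y _
    have h := ((hasDerivAt_abs_rpow (t - y) hρ).comp y ((hasDerivAt_id y).const_sub t)).neg
    exact h.congr_deriv (by ring)
  have h := integral_eq_sub_of_hasDerivAt hderiv (hi.const_mul ρ)
  rw [intervalIntegral.integral_const_mul] at h
  linarith

/-- For `ρ > 1` and `T` nondecreasing, the function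
`ψ(x) = ρ ∫₀ˣ |T x' - x'|^(ρ-2) (T x' - x') dx'` satisfies
`ψ x - ψ z ≤ |T x - z|^ρ - |T x - x|^ρ` for all `x, z`, and consequently
`ψ x + |T x - x|^ρ = ⨅ z, (ψ z + |T x - z|^ρ)`. -/
theorem stmt0 (ρ : ℝ) (hρ : 1 < ρ) (T : ℝ → ℝ) (hT : Monotone T)
    (hint : ∀ a b : ℝ,
      IntervalIntegrable (fun x' => |T x' - x'| ^ (ρ - 2) * (T x' - x')) volume a b)
    (ψ : ℝ → ℝ)
    (hψ : ∀ x, ψ x = ρ * ∫ x' in (0:ℝ)..x, |T x' - x'| ^ (ρ - 2) * (T x' - x')) :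
    (∀ x z : ℝ, ψ x - ψ z ≤ |T x - z| ^ ρ - |T x - x| ^ ρ) ∧
    (∀ x : ℝ, ψ x + |T x - x| ^ ρ = ⨅ z : ℝ, (ψ z + |T x - z| ^ ρ)) := by
  have main : ∀ x z : ℝ, ψ x - ψ z ≤ |T x - z| ^ ρ - |T x - x| ^ ρ := by
    intro x z
    have hdiff : ψ x - ψ z = ρ * ∫ y in z..x, |T y - y| ^ (ρ - 2) * (T y - y) := by
      rw [hψ x, hψ z, ← mul_sub, integral_interval_sub_left (hint 0 x) (hint 0 z)]
    obtain ⟨hi, hFTC⟩ := integral_abs_sub_rpow_sub_two_mul hρ (T x) z x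
    rw [hdiff, ← hFTC]
    refine mul_le_mul_of_nonneg_left ?_ (by linarith)
    have hmono := monotone_abs_rpow_sub_two_mul_self hρ
    rcases le_total z x with hzx | hxz
    · exact integral_mono_on hzx (hint z x) hi fun y hy =>
        hmono (sub_le_sub_right (hT hy.2) y)
    · rw [integral_symm x z, integral_symm x z]
      exact neg_le_neg (integral_mono_on hxz hi.symm (hint x z) fun y hy =>
        hmono (sub_le_sub_right (hT hy.1) y))
  refine ⟨main, fun x => ?_⟩
  have hle : ∀ z, ψ x + |T x - x| ^ ρ ≤ ψ z + |T x - z| ^ ρ := fun z => by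
    linarith [main x z]
  exact le_antisymm (le_ciInf hle)
    (ciInf_le ⟨ψ x + |T x - x| ^ ρ, Set.forall_mem_range.2 hle⟩ x)
end

section
/- Let X and X̃ be real random variables with laws P and P̃, cumulative distribution functions F and F̃, and let F̃^{-1}(u)=inf{x: F̃(x)>u}. Assume F is continuous and that X̃ is bounded from below, i.e. F̃^{-1}(0⁺):=lim_{u→0⁺}F̃^{-1}(u) > −∞. Set T(x)=F̃^{-1}(F(x)). Then for every q>0 and every y>0, ∫_ℝ |T(x−y)|^q P(dx) ≤ |F̃^{-1}(0⁺)|^q + E[|X̃|^q]. -/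
open MeasureTheory Set
open scoped ENNReal

open ProbabilityTheory Filter in
lemma exists_cdf_eq (P : Measure ℝ) (hc : Continuous (cdf P)) {c : ℝ}
    (h0 : 0 < c) (h1 : c < 1) : ∃ x, cdf P x = c := by
  obtain ⟨a, ha⟩ := ((tendsto_cdf_atBot P).eventually_lt_const h0).exists
  obtain ⟨b, hb⟩ := ((tendsto_cdf_atTop P).eventually_const_lt h1).exists
  exact mem_range_of_exists_le_of_exists_ge hc ⟨a, ha.le⟩ ⟨b, hb.le⟩

open ProbabilityTheory in
lemma measureReal_cdf_le_le (P : Measure ℝ) [IsProbabilityMeasure P]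
    (hc : Continuous (cdf P)) {c : ℝ} (h0 : 0 ≤ c) : P.real {x | cdf P x ≤ c} ≤ c := by
  refine le_of_forall_gt_imp_ge_of_dense fun d hd ↦ ?_
  rcases lt_or_ge d 1 with h1 | h1
  · obtain ⟨x, hx⟩ := exists_cdf_eq P hc (h0.trans_lt hd) h1
    rw [← hx, cdf_eq_real]
    refine measureReal_mono fun z hz ↦ ?_
    by_contra hzx
    have := monotone_cdf P (not_le.1 hzx).le
    rw [mem_ofPred_eq] at hz
    linarith
  · exact measureReal_le_one.trans h1

open ProbabilityTheory in
lemma le_measureReal_cdf_lt (P : Measure ℝ) [IsProbabilityMeasure P]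
    (hc : Continuous (cdf P)) {c : ℝ} (h1 : c ≤ 1) : c ≤ P.real {x | cdf P x < c} := by
  refine le_of_forall_lt_imp_le_of_dense fun d hd ↦ ?_
  rcases lt_or_ge 0 d with h0 | h0
  · obtain ⟨x, hx⟩ := exists_cdf_eq P hc h0 (hd.trans_le h1)
    rw [← hx, cdf_eq_real]
    exact measureReal_mono fun z hz ↦ ((monotone_cdf P hz).trans hx.le).trans_lt hd
  · exact h0.trans measureReal_nonneg

open ProbabilityTheory in
lemma ae_cdf_lt_one (P : Measure ℝ) [IsProbabilityMeasure P]
    (hc : Continuous (cdf P)) : ∀ᵐ x ∂P, cdf P x < 1 := by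
  have h : P.real {x | cdf P x < 1} = 1 :=
    le_antisymm measureReal_le_one (le_measureReal_cdf_lt P hc le_rfl)
  have hm : MeasurableSet {x | cdf P x < 1} := measurableSet_lt hc.measurable measurable_const
  rw [measureReal_def, ENNReal.toReal_eq_one_iff] at h
  exact (prob_compl_eq_zero_iff hm).2 h

open ProbabilityTheory Filter in
lemma bddBelow_lt_cdf (Q : Measure ℝ) {u : ℝ} (hu : 0 < u) :
    BddBelow {x : ℝ | u < cdf Q x} := by
  obtain ⟨a, ha⟩ := ((tendsto_cdf_atBot Q).eventually_lt_const hu).exists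
  refine ⟨a, fun x hx ↦ ?_⟩
  by_contra hxa
  have := monotone_cdf Q (not_le.1 hxa).le
  rw [mem_ofPred_eq] at hx
  linarith

open ProbabilityTheory Filter in
lemma nonempty_lt_cdf (Q : Measure ℝ) {u : ℝ} (hu : u < 1) :
    {x : ℝ | u < cdf Q x}.Nonempty :=
  ((tendsto_cdf_atTop Q).eventually_const_lt hu).exists

open ProbabilityTheory Filter in
lemma le_cdf_of_sInf_le (Q : Measure ℝ) {u a : ℝ} (hu : u < 1)
    (h : sInf {x : ℝ | u < cdf Q x} ≤ a) : u ≤ cdf Q a := by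
  have hr : Tendsto (cdf Q) (nhdsWithin a (Ioi a)) (nhds (cdf Q a)) :=
    ((cdf Q).right_continuous a).mono Ioi_subset_Ici_self
  refine ge_of_tendsto hr ?_
  filter_upwards [self_mem_nhdsWithin] with b hb
  obtain ⟨x, hx, hxb⟩ := exists_lt_of_csInf_lt (nonempty_lt_cdf Q hu) (h.trans_lt hb)
  exact (le_of_lt hx).trans (monotone_cdf Q hxb.le)

open ProbabilityTheory Filter in
/-- A finite right limit at `0` of the pseudo-inverse bounds the support from below. -/
lemma mem_lowerBounds_pos_cdf (Q : Measure ℝ) {L : ℝ}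
    (hL : Tendsto (fun u ↦ sInf {x : ℝ | u < cdf Q x}) (nhdsWithin 0 (Ioi 0)) (nhds L)) :
    L ∈ lowerBounds {x : ℝ | 0 < cdf Q x} := by
  intro x hx
  refine le_of_tendsto hL ?_
  filter_upwards [Ioo_mem_nhdsGT (show (0 : ℝ) < cdf Q x from hx)] with u hu
  exact csInf_le (bddBelow_lt_cdf Q hu.1) hu.2

open ProbabilityTheory in
lemma monotoneOn_sInf_lt_cdf (Q : Measure ℝ) (hb : BddBelow {x : ℝ | 0 < cdf Q x}) :
    MonotoneOn (fun u ↦ sInf {x : ℝ | u < cdf Q x}) (Ico 0 1) := fun _ hu _ hv huv ↦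
  csInf_le_csInf (hb.mono fun _ hx ↦ hu.1.trans_lt hx) (nonempty_lt_cdf Q hv.2)
    fun _ hx ↦ huv.trans_lt hx

open ProbabilityTheory in
lemma aemeasurable_sInf_lt_cdf (P Q : Measure ℝ) [IsProbabilityMeasure P]
    (hc : Continuous (cdf P)) (hb : BddBelow {x : ℝ | 0 < cdf Q x}) :
    AEMeasurable (fun z ↦ sInf {x : ℝ | cdf P z < cdf Q x}) P := by
  have hm : MeasurableSet {x | cdf P x < 1} := measurableSet_lt hc.measurable measurable_const
  have h : AEMeasurable (fun z ↦ sInf {x : ℝ | cdf P z < cdf Q x})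
      (P.restrict {x | cdf P x < 1}) :=
    aemeasurable_restrict_of_monotoneOn hm fun x hx z hz hxz ↦
      monotoneOn_sInf_lt_cdf Q hb ⟨cdf_nonneg P x, hx⟩ ⟨cdf_nonneg P z, hz⟩
        (monotone_cdf P hxz)
  rwa [Measure.restrict_eq_self_of_ae_mem (s := {x | cdf P x < 1}) (ae_cdf_lt_one P hc)] at h

open ProbabilityTheory in
/-- The increasing rearrangement `F_Q⁻¹ ∘ F_P` transports `P` to `Q`. -/
lemma map_sInf_lt_cdf (P Q : Measure ℝ) [IsProbabilityMeasure P] [IsProbabilityMeasure Q]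
    (hc : Continuous (cdf P)) (hb : BddBelow {x : ℝ | 0 < cdf Q x}) :
    P.map (fun z ↦ sInf {x : ℝ | cdf P z < cdf Q x}) = Q := by
  have hT := aemeasurable_sInf_lt_cdf P Q hc hb
  have := Measure.isProbabilityMeasure_map hT
  refine Measure.ext_of_Iic _ _ fun a ↦ ?_
  rw [Measure.map_apply_of_aemeasurable hT measurableSet_Iic,
    ← measureReal_eq_measureReal_iff, ← cdf_eq_real Q]
  refine le_antisymm ?_ ?_
  · refine le_trans ?_ (measureReal_cdf_le_le P hc (cdf_nonneg Q a))
    refine ENNReal.toReal_mono (measure_ne_top _ _) (measure_mono_ae ?_)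
    filter_upwards [ae_cdf_lt_one P hc] with z hz hza
    exact le_cdf_of_sInf_le Q hz hza
  · refine (le_measureReal_cdf_lt P hc (cdf_le_one Q a)).trans (measureReal_mono fun z hz ↦ ?_)
    exact csInf_le (hb.mono fun _ hx ↦ (cdf_nonneg P z).trans_lt hx) hz

/-- if `X̃` is bounded from below (the pseudo-inverse `F̃⁻¹` has a finite
right limit `L` at `0⁺`), then `∫ |T(x-y)|^q P(dx) ≤ |L|^q + E[|X̃|^q]`. -/
theorem stmt4 (P Pt : Measure ℝ) [IsProbabilityMeasure P] [IsProbabilityMeasure Pt]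
    (F Ft : ℝ → ℝ)
    (hF : ∀ x, F x = (P (Iic x)).toReal) (hFt : ∀ x, Ft x = (Pt (Iic x)).toReal)
    (hFc : Continuous F)
    (Ftinv : ℝ → ℝ) (hFtinv : ∀ u, Ftinv u = sInf {x : ℝ | u < Ft x})
    (L : ℝ) (hL : Filter.Tendsto Ftinv (nhdsWithin 0 (Ioi 0)) (nhds L))
    (T : ℝ → ℝ) (hT : ∀ x, T x = Ftinv (F x))
    (q y : ℝ) (hq : 0 < q) (hy : 0 < y) :
    ∫⁻ x, ENNReal.ofReal (|T (x - y)| ^ q) ∂P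
      ≤ ENNReal.ofReal (|L| ^ q) + ∫⁻ z, ENNReal.ofReal (|z| ^ q) ∂Pt := by
  obtain rfl : F = ProbabilityTheory.cdf P :=
    funext fun x ↦ (hF x).trans (ProbabilityTheory.cdf_eq_real P x).symm
  obtain rfl : Ft = ProbabilityTheory.cdf Pt :=
    funext fun x ↦ (hFt x).trans (ProbabilityTheory.cdf_eq_real Pt x).symm
  obtain rfl : Ftinv = _ := funext hFtinv
  obtain rfl : T = _ := funext hT
  have hlb := mem_lowerBounds_pos_cdf Pt hL
  have hb : BddBelow _ := ⟨L, hlb⟩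
  have hTm := aemeasurable_sInf_lt_cdf P Pt hFc hb
  have hmap := lintegral_map' (μ := P) (f := fun z ↦ ENNReal.ofReal (|z| ^ q))
    (by fun_prop) hTm
  rw [map_sInf_lt_cdf P Pt hFc hb] at hmap
  have hconst : ENNReal.ofReal (|L| ^ q) = ∫⁻ _, ENNReal.ofReal (|L| ^ q) ∂P := by simp
  rw [hmap, hconst, ← lintegral_add_left measurable_const]
  refine lintegral_mono_ae ?_
  filter_upwards [ae_cdf_lt_one P hFc] with x hx
  have hxy : ProbabilityTheory.cdf P (x - y) ≤ ProbabilityTheory.cdf P x :=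
    ProbabilityTheory.monotone_cdf P (by linarith)
  have h0 := ProbabilityTheory.cdf_nonneg P (x - y)
  have hle := monotoneOn_sInf_lt_cdf Pt hb ⟨h0, hxy.trans_lt hx⟩ ⟨h0.trans hxy, hx⟩ hxy
  have hge : L ≤ sInf {z : ℝ | ProbabilityTheory.cdf P (x - y) < ProbabilityTheory.cdf Pt z} :=
    le_csInf (nonempty_lt_cdf Pt (hxy.trans_lt hx)) fun z hz ↦ hlb (h0.trans_lt hz)
  rw [← ENNReal.ofReal_add (by positivity) (by positivity)]
  refine ENNReal.ofReal_le_ofReal ?_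
  rcases le_max_iff.1 (abs_le_max_abs_abs hge hle) with h | h
  · exact (Real.rpow_le_rpow (abs_nonneg _) h hq.le).trans
      (le_add_of_nonneg_right (by positivity))
  · exact (Real.rpow_le_rpow (abs_nonneg _) h hq.le).trans
      (le_add_of_nonneg_left (by positivity))
end

section
/- Let ρ≥1 and consider two pure jump Markov processes on ℝ^d with data (λ,k,P₀) and (λ̃,k̃,P̃₀) and time marginals {P_t}, {P̃_t}, with λ̄:=sup_x max(λ(x),λ̃(x))<∞, and assume t ↦ ∫|x|^{ρ(1+ε)}P_t(dx)+∫|x|^{ρ(1+ε)}P̃_t(dx) is locally bounded for some ε>0. For each t≥0 let (ψ_t,ψ̃_t) be a pair of Kantorovich potentials associated with W_ρ(P_t,P̃_t). Then for every δ∈[0,ε): (a) (t,r) ↦ ∫|ψ_t(x)−P_t(ψ_t)|^{1+δ} P_r(dx) is locally bounded on (0,∞)×[0,∞); (b) (t,r) ↦ ∫ ( ∫ λ(x)k(x,dy)|ψ_t(y)−ψ_t(x)| )^{1+δ} P_r(dx) is locally bounded on (0,∞)×(0,∞); (c) t ↦ ∫∫ λ(x)k(x,dy)|ψ_t(y)−ψ_t(x)|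 P_t(dx) is locally integrable on [0,∞). -/
open MeasureTheory ProbabilityTheory
open scoped ENNReal

/-- `π` is a coupling of `P` and `Q`. -/
def IsCoupling {E : Type*} [MeasurableSpace E] (π : Measure (E × E)) (P Q : Measure E) : Prop :=
  π.map Prod.fst = P ∧ π.map Prod.snd = Q

/-- `wassersteinPow ρ P Q = W_ρ^ρ(P, Q)`. -/
noncomputable def wassersteinPow {E : Type*} [MeasurableSpace E] [NormedAddCommGroup E]
    (ρ : ℝ) (P Q : Measure E) : ℝ :=
  sInf {c : ℝ | ∃ π : Measure (E × E), IsCoupling π P Q ∧ c = ∫ p, ‖p.1 - p.2‖ ^ ρ ∂π}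

/-- `(ψ, ψt)` is a pair of Kantorovich potentials associated with `W_ρ(P, Q)`. -/
def IsKantorovichPair {E : Type*} [MeasurableSpace E] [NormedAddCommGroup E]
    (ρ : ℝ) (P Q : Measure E) (ψ ψt : E → ℝ) : Prop :=
  Integrable ψ P ∧ Integrable ψt Q ∧
  (∀ x, ψ x = - ⨅ y : E, (‖x - y‖ ^ ρ + ψt y)) ∧
  (∀ y, ψt y = - ⨅ x : E, (‖x - y‖ ^ ρ + ψ x)) ∧
  wassersteinPow ρ P Q = - ∫ x, ψ x ∂P - ∫ y, ψt y ∂Q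

/-- The measure `P_{n,t}` of the pure jump Markov process, defined recursively over the
last jump time. -/
noncomputable def jumpMarginalN {E : Type*} [MeasurableSpace E]
    (l : E → ℝ) (k : Kernel E E) (P0 : Measure E) : ℕ → ℝ → Measure E
  | 0, t => P0.withDensity fun x => ENNReal.ofReal (Real.exp (-(l x) * t))
  | n + 1, t =>
      (volume.restrict (Set.Icc (0:ℝ) t)).bind fun s =>
        ((jumpMarginalN l k P0 n s).withDensity fun x => ENNReal.ofReal (l x)).bind
          fun x => (k x).withDensity fun y => ENNReal.ofReal (Real.exp (-(l y) * (t - s)))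

/-- The time-`t` marginal `P_t = Σ_n P_{n,t}`. -/
noncomputable def jumpMarginal {E : Type*} [MeasurableSpace E]
    (l : E → ℝ) (k : Kernel E E) (P0 : Measure E) (t : ℝ) : Measure E :=
  Measure.sum fun n => jumpMarginalN l k P0 n t

section JumpProcess

variable {E : Type*} [MeasurableSpace E] {l : E → ℝ} {k : Kernel E E} {P0 : Measure E}

/-- Lebesgue measure on `[0,t]`, as a kernel in `t`. -/
noncomputable def volumeIccKernel : Kernel ℝ ℝ :=
  (Kernel.const ℝ (volume : Measure ℝ)).withDensity fun t s =>
    (({p : ℝ × ℝ | p.2 ∈ Set.Icc 0 p.1}.indicator (fun _ => (1 : NNReal)) (t, s) : NNReal) : ℝ≥0∞)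

instance : IsSFiniteKernel volumeIccKernel := by
  unfold volumeIccKernel
  infer_instance

lemma volumeIccKernel_apply (t : ℝ) :
    volumeIccKernel t = volume.restrict (Set.Icc 0 t) := by
  have hS : MeasurableSet {p : ℝ × ℝ | p.2 ∈ Set.Icc 0 p.1} :=
    (measurableSet_le measurable_const measurable_snd).inter
      (measurableSet_le measurable_snd measurable_fst)
  unfold volumeIccKernel
  rw [Kernel.withDensity_apply, Kernel.const_apply,
    ← withDensity_indicator_one (measurableSet_Icc (a := (0 : ℝ)) (b := t))]
  · congr 1
    ext s
    simp only [Set.indicator, Set.mem_ofPred_eq, Pi.one_apply]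
    split_ifs <;> simp
  · exact (measurable_const.indicator hS).coe_nnreal_ennreal

lemma measurable_decay (hl : Measurable l) (c : ℝ) :
    Measurable fun y => ENNReal.ofReal (Real.exp (-(l y) * c)) :=
  ENNReal.measurable_ofReal.comp (Real.measurable_exp.comp (hl.neg.mul_const c))

lemma bind_withDensity_eq [IsMarkovKernel k] (μ : Measure E)
    {g : E → ℝ≥0∞} (hg : Measurable g) :
    (μ.withDensity fun x => ENNReal.ofReal (l x)).bind (fun x => (k x).withDensity g) =
      ((μ.withDensity fun x => ENNReal.ofReal (l x)).bind k).withDensity g := by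
  have hK : ∀ x, (k.withDensity fun _ => g) x = (k x).withDensity g := fun x =>
    Kernel.withDensity_apply _ (by exact hg.comp measurable_snd) x
  have hm : Measurable fun x => (k x).withDensity g := by
    simp_rw [← hK]; exact Kernel.measurable _
  refine Measure.ext_of_lintegral _ fun f hf => ?_
  rw [Measure.lintegral_bind hm.aemeasurable hf.aemeasurable,
    lintegral_withDensity_eq_lintegral_mul _ hg hf,
    Measure.lintegral_bind k.aemeasurable (hg.mul hf).aemeasurable]
  simp_rw [lintegral_withDensity_eq_lintegral_mul _ hg hf]

lemma measurable_withDensity_decay (hl : Measurable l) (η : Kernel ℝ E) [IsSFiniteKernel η]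
    (t : ℝ) : Measurable fun s => (η s).withDensity
      fun y => ENNReal.ofReal (Real.exp (-(l y) * (t - s))) := by
  have hg : Measurable (Function.uncurry fun s y =>
      ENNReal.ofReal (Real.exp (-(l y) * (t - s)))) := by
    unfold Function.uncurry
    fun_prop
  have := (η.withDensity fun s y => ENNReal.ofReal (Real.exp (-(l y) * (t - s)))).measurable
  convert this using 2 with s
  exact (Kernel.withDensity_apply _ hg s).symm

/-- The law of the post-jump position for a jump out of the law `κ s`. -/
noncomputable def jumpFlux (l : E → ℝ) (k : Kernel E E) (κ : Kernel ℝ E)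
    [IsSFiniteKernel κ] : Kernel ℝ E :=
  k ∘ₖ κ.withDensity fun _ x => ENNReal.ofReal (l x)

instance [IsMarkovKernel k] (κ : Kernel ℝ E) [IsSFiniteKernel κ] :
    IsSFiniteKernel (jumpFlux l k κ) := by
  have := Kernel.IsSFiniteKernel.withDensity κ (f := fun _ x => ENNReal.ofReal (l x))
    (fun _ _ => ENNReal.ofReal_ne_top)
  unfold jumpFlux
  infer_instance

lemma jumpFlux_apply (hl : Measurable l) (κ : Kernel ℝ E) [IsSFiniteKernel κ] (s : ℝ) :
    jumpFlux l k κ s = ((κ s).withDensity fun x => ENNReal.ofReal (l x)).bind k := by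
  unfold jumpFlux
  rw [Kernel.comp_apply, Kernel.withDensity_apply]
  exact (hl.comp measurable_snd).ennreal_ofReal

lemma lintegral_jumpFlux (hl : Measurable l) (κ : Kernel ℝ E) [IsSFiniteKernel κ] (s : ℝ)
    {f : E → ℝ≥0∞} (hf : Measurable f) :
    ∫⁻ y, f y ∂(jumpFlux l k κ s) =
      ∫⁻ x, ENNReal.ofReal (l x) * ∫⁻ y, f y ∂(k x) ∂(κ s) := by
  rw [jumpFlux_apply hl, Measure.lintegral_bind k.aemeasurable hf.aemeasurable,
    lintegral_withDensity_eq_lintegral_mul _ hl.ennreal_ofReal hf.lintegral_kernel]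
  rfl

lemma jumpMarginalN_succ_eq (hl : Measurable l) [IsMarkovKernel k] {n : ℕ}
    {κ : Kernel ℝ E} [IsSFiniteKernel κ] (hκ : ∀ t, κ t = jumpMarginalN l k P0 n t) (t : ℝ) :
    jumpMarginalN l k P0 (n + 1) t = (volume.restrict (Set.Icc (0 : ℝ) t)).bind fun s =>
      (jumpFlux l k κ s).withDensity fun y => ENNReal.ofReal (Real.exp (-(l y) * (t - s))) := by
  rw [jumpMarginalN]
  congr 1
  ext1 s
  rw [jumpFlux_apply hl, ← hκ,
    bind_withDensity_eq _ (measurable_decay hl _)]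

lemma lintegral_jumpMarginalN_succ_flux (hl : Measurable l) [IsMarkovKernel k] {n : ℕ}
    {κ : Kernel ℝ E} [IsSFiniteKernel κ] (hκ : ∀ t, κ t = jumpMarginalN l k P0 n t) (t : ℝ)
    {f : E → ℝ≥0∞} (hf : Measurable f) :
    ∫⁻ y, f y ∂(jumpMarginalN l k P0 (n + 1) t) = ∫⁻ s in Set.Icc (0 : ℝ) t,
      ∫⁻ y, ENNReal.ofReal (Real.exp (-(l y) * (t - s))) * f y ∂(jumpFlux l k κ s) := by
  rw [jumpMarginalN_succ_eq hl hκ, Measure.lintegral_bind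
    (measurable_withDensity_decay hl _ t).aemeasurable hf.aemeasurable]
  simp_rw [lintegral_withDensity_eq_lintegral_mul _ (measurable_decay hl _) hf]
  rfl

lemma exists_kernel_eq_jumpMarginalN (hl : Measurable l) [IsMarkovKernel k] [SFinite P0] (n : ℕ) :
    ∃ κ : Kernel ℝ E, IsSFiniteKernel κ ∧ ∀ t, κ t = jumpMarginalN l k P0 n t := by
  induction n with
  | zero =>
    refine ⟨(Kernel.const ℝ P0).withDensity fun t x => ENNReal.ofReal (Real.exp (-(l x) * t)),
      Kernel.IsSFiniteKernel.withDensity _ fun _ _ => ENNReal.ofReal_ne_top, fun t => ?_⟩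
    rw [Kernel.withDensity_apply, Kernel.const_apply, jumpMarginalN]
    unfold Function.uncurry
    fun_prop
  | succ n ih =>
    obtain ⟨κ, hsf, hκ⟩ := ih
    let g : ℝ → ℝ × E → ℝ≥0∞ := fun t p => ENNReal.ofReal (Real.exp (-(l p.2) * (t - p.1)))
    have hg : Measurable (Function.uncurry g) := by
      unfold Function.uncurry
      fun_prop
    have hsf' : IsSFiniteKernel
        ((volumeIccKernel ⊗ₖ Kernel.prodMkLeft ℝ (jumpFlux l k κ)).withDensity g) :=
      Kernel.IsSFiniteKernel.withDensity _ fun _ _ => ENNReal.ofReal_ne_top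
    refine ⟨((volumeIccKernel ⊗ₖ Kernel.prodMkLeft ℝ (jumpFlux l k κ)).withDensity g).map Prod.snd,
      inferInstance, fun t => Measure.ext_of_lintegral _ fun f hf => ?_⟩
    rw [Kernel.lintegral_map _ measurable_snd _ hf,
      Kernel.lintegral_withDensity (g := fun p => f p.2) _ hg _ (hf.comp measurable_snd),
      Kernel.lintegral_compProd _ _ _ (by
        exact (hg.comp (measurable_const.prodMk measurable_id)).mul (hf.comp measurable_snd)),
      volumeIccKernel_apply, lintegral_jumpMarginalN_succ_flux hl hκ t hf]
    rfl

lemma lintegral_jumpMarginalN_succ (hl : Measurable l) [IsMarkovKernel k] [SFinite P0] (n : ℕ)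
    (t : ℝ) {f : E → ℝ≥0∞} (hf : Measurable f) :
    ∫⁻ y, f y ∂(jumpMarginalN l k P0 (n + 1) t) = ∫⁻ s in Set.Icc (0 : ℝ) t,
      ∫⁻ x, ENNReal.ofReal (l x) *
        ∫⁻ y, ENNReal.ofReal (Real.exp (-(l y) * (t - s))) * f y ∂(k x)
          ∂(jumpMarginalN l k P0 n s) := by
  obtain ⟨κ, hsf, hκ⟩ := exists_kernel_eq_jumpMarginalN (P0 := P0) (k := k) hl n
  rw [lintegral_jumpMarginalN_succ_flux hl hκ t hf]
  refine lintegral_congr fun s => ?_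
  rw [lintegral_jumpFlux hl κ s
    (f := fun y => ENNReal.ofReal (Real.exp (-(l y) * (t - s))) * f y)
    ((measurable_decay hl _).mul hf), hκ]

lemma lintegral_jumpMarginalN_zero (hl : Measurable l) (t : ℝ) {f : E → ℝ≥0∞}
    (hf : Measurable f) :
    ∫⁻ y, f y ∂(jumpMarginalN l k P0 0 t) =
      ∫⁻ y, ENNReal.ofReal (Real.exp (-(l y) * t)) * f y ∂P0 := by
  rw [jumpMarginalN, lintegral_withDensity_eq_lintegral_mul _ (measurable_decay hl _) hf]
  rfl

lemma lintegral_jumpMarginal (t : ℝ) (f : E → ℝ≥0∞) :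
    ∫⁻ x, f x ∂(jumpMarginal l k P0 t) = ∑' n, ∫⁻ x, f x ∂(jumpMarginalN l k P0 n t) :=
  lintegral_sum_measure _ _

lemma measurable_rate_mul_lintegral (hl : Measurable l) {f : E → ℝ≥0∞} (hf : Measurable f) :
    Measurable fun x => ENNReal.ofReal (l x) * ∫⁻ y, f y ∂(k x) :=
  hl.ennreal_ofReal.mul hf.lintegral_kernel

lemma setLIntegral_Icc_zero_mul {c : ℝ} (hc : 0 < c) (t : ℝ) (F : ℝ → ℝ≥0∞) :
    ∫⁻ s in Set.Icc 0 (c * t), F s = ENNReal.ofReal c * ∫⁻ s in Set.Icc 0 t, F (c * s) := by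
  have hpre : (fun x => c * x) ⁻¹' Set.Icc 0 (c * t) = Set.Icc 0 t := by
    ext x
    simp only [Set.mem_preimage, Set.mem_Icc]
    exact and_congr (by rw [mul_nonneg_iff_of_pos_left hc]) (by rw [mul_le_mul_iff_right₀ hc])
  have hemb : MeasurableEmbedding fun x : ℝ => c * x :=
    (Homeomorph.mulLeft₀ c hc.ne').measurableEmbedding
  have h := Real.smul_map_volume_mul_left hc.ne'
  rw [abs_of_pos hc] at h
  conv_lhs => rw [← h]
  rw [Measure.restrict_smul, lintegral_smul_measure, hemb.restrict_map, hpre, hemb.lintegral_map]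
  rfl

lemma lintegral_jumpMarginalN_mul_le (hl : Measurable l) (hl0 : ∀ x, 0 ≤ l x) [IsMarkovKernel k]
    [SFinite P0] {c : ℝ} (hc : 1 ≤ c) (n : ℕ) {t : ℝ} (ht : 0 ≤ t) {f : E → ℝ≥0∞}
    (hf : Measurable f) :
    ∫⁻ x, f x ∂(jumpMarginalN l k P0 n (c * t)) ≤
      ENNReal.ofReal c ^ n * ∫⁻ x, f x ∂(jumpMarginalN l k P0 n t) := by
  have hdecay : ∀ y, ∀ u : ℝ, 0 ≤ u →
      ENNReal.ofReal (Real.exp (-(l y) * (c * u))) ≤ ENNReal.ofReal (Real.exp (-(l y) * u)) := by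
    intro y u hu
    refine ENNReal.ofReal_le_ofReal (Real.exp_le_exp.2 ?_)
    nlinarith [mul_nonneg (mul_nonneg (hl0 y) hu) (sub_nonneg.2 hc)]
  induction n generalizing t f with
  | zero =>
    rw [lintegral_jumpMarginalN_zero hl _ hf, lintegral_jumpMarginalN_zero hl _ hf, pow_zero,
      one_mul]
    exact lintegral_mono fun y => mul_le_mul' (hdecay y t ht) le_rfl
  | succ n ih =>
    rw [lintegral_jumpMarginalN_succ hl _ _ hf, lintegral_jumpMarginalN_succ hl _ _ hf,
      setLIntegral_Icc_zero_mul (by linarith), pow_succ', mul_assoc,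
      ← lintegral_const_mul' (ENNReal.ofReal c ^ n) _ (by finiteness)]
    refine mul_le_mul' le_rfl (setLIntegral_mono' measurableSet_Icc fun s hs => ?_)
    refine (ih hs.1 (measurable_rate_mul_lintegral hl ((measurable_decay hl _).mul hf))).trans ?_
    refine mul_le_mul' le_rfl (lintegral_mono fun x => mul_le_mul' le_rfl
      (lintegral_mono fun y => ?_))
    simp only [← mul_sub]
    exact mul_le_mul' (hdecay y _ (by linarith [hs.2])) le_rfl

lemma lintegral_jumpMarginalN_le_exp (hl : Measurable l) {lbar : ℝ} (hlbar : ∀ x, l x ≤ lbar)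
    [IsMarkovKernel k] [SFinite P0] (n : ℕ) {r t : ℝ} (hrt : r ≤ t) {f : E → ℝ≥0∞}
    (hf : Measurable f) :
    ∫⁻ x, f x ∂(jumpMarginalN l k P0 n r) ≤
      ENNReal.ofReal (Real.exp (lbar * (t - r))) * ∫⁻ x, f x ∂(jumpMarginalN l k P0 n t) := by
  have hdecay : ∀ y, ∀ s : ℝ, ENNReal.ofReal (Real.exp (-(l y) * (r - s))) ≤
      ENNReal.ofReal (Real.exp (lbar * (t - r))) *
        ENNReal.ofReal (Real.exp (-(l y) * (t - s))) := by
    intro y s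
    rw [← ENNReal.ofReal_mul (Real.exp_nonneg _), ← Real.exp_add]
    refine ENNReal.ofReal_le_ofReal (Real.exp_le_exp.2 ?_)
    nlinarith [mul_nonneg (sub_nonneg.2 (hlbar y)) (sub_nonneg.2 hrt)]
  cases n with
  | zero =>
    rw [lintegral_jumpMarginalN_zero hl _ hf, lintegral_jumpMarginalN_zero hl _ hf,
      ← lintegral_const_mul' _ _ (by finiteness)]
    refine lintegral_mono fun y => ?_
    rw [← mul_assoc]
    exact mul_le_mul' (by simpa using hdecay y 0) le_rfl
  | succ n =>
    rw [lintegral_jumpMarginalN_succ hl _ _ hf, lintegral_jumpMarginalN_succ hl _ _ hf,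
      ← lintegral_const_mul' _ _ (by finiteness)]
    refine (lintegral_mono_set (Set.Icc_subset_Icc_right hrt)).trans ?_
    refine lintegral_mono fun s => ?_
    rw [← lintegral_const_mul' _ _ (by finiteness)]
    refine lintegral_mono fun x => ?_
    rw [mul_left_comm, ← lintegral_const_mul' (ENNReal.ofReal (Real.exp (lbar * (t - r)))) _
      (by finiteness)]
    refine mul_le_mul' le_rfl (lintegral_mono fun y => ?_)
    rw [← mul_assoc]
    exact mul_le_mul' (hdecay y s) le_rfl

lemma lintegral_jumpMarginalN_le (hl : Measurable l) (hl0 : ∀ x, 0 ≤ l x) {lbar : ℝ}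
    (hlbar : ∀ x, l x ≤ lbar) (hlbar0 : 0 ≤ lbar)
    [IsMarkovKernel k] [SFinite P0] (n : ℕ) {a b c r t : ℝ} (ha : 0 < a) (hat : a ≤ t) (htb : t ≤ b)
    (hr : 0 ≤ r) (hc : 1 ≤ c) (hrc : r ≤ c * a) {f : E → ℝ≥0∞} (hf : Measurable f) :
    ∫⁻ x, f x ∂(jumpMarginalN l k P0 n r) ≤ ENNReal.ofReal (Real.exp (lbar * b)) *
      (ENNReal.ofReal c ^ n * ∫⁻ x, f x ∂(jumpMarginalN l k P0 n t)) := by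
  have ht : 0 < t := ha.trans_le hat
  rcases le_total r t with hrt | hrt
  · refine (lintegral_jumpMarginalN_le_exp hl hlbar n hrt hf).trans ?_
    gcongr ?_ * ?_
    · exact ENNReal.ofReal_le_ofReal (Real.exp_le_exp.2
        (mul_le_mul_of_nonneg_left (by linarith) hlbar0))
    · exact le_mul_of_one_le_left zero_le (one_le_pow₀ (by simpa using hc))
  · have h := lintegral_jumpMarginalN_mul_le (k := k) (P0 := P0) hl hl0 (c := r / t)
      ((one_le_div ht).2 hrt) n ht.le hf
    rw [div_mul_cancel₀ _ ht.ne'] at h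
    refine h.trans ((?_ : _ ≤ ENNReal.ofReal c ^ n * _).trans (le_mul_of_one_le_left zero_le ?_))
    · gcongr
      exact (div_le_iff₀ ht).2 (hrc.trans (by gcongr))
    · simpa using mul_nonneg hlbar0 (ht.le.trans htb)

lemma lintegral_Icc_div_pow (n : ℕ) {r : ℝ} (hr : 0 < r) :
    ∫⁻ s in Set.Ioc 0 r, ENNReal.ofReal (s / r) ^ n = ENNReal.ofReal (r / (n + 1)) := by
  have h1 : ∀ s ∈ Set.Ioc 0 r, ENNReal.ofReal (s / r) ^ n = ENNReal.ofReal ((s / r) ^ n) :=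
    fun s hs => (ENNReal.ofReal_pow (div_nonneg hs.1.le hr.le) n).symm
  rw [setLIntegral_congr_fun measurableSet_Ioc h1,
    ← ofReal_integral_eq_lintegral_ofReal]
  · rw [← intervalIntegral.integral_of_le hr.le]
    congr 1
    simp_rw [div_pow]
    rw [intervalIntegral.integral_div, integral_pow]
    field_simp
    simp [pow_succ]
  · exact (Continuous.integrableOn_Icc (by fun_prop)).mono_set Set.Ioc_subset_Icc_self
  · filter_upwards [ae_restrict_mem measurableSet_Ioc] with s hs
    exact pow_nonneg (div_nonneg hs.1.le hr.le) n

/-- A jump out of `P_{n,r}` is controlled by `P_{n+1,r}`. -/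
lemma lintegral_jumpMarginalN_rate_le (hl : Measurable l) (hl0 : ∀ x, 0 ≤ l x) {lbar : ℝ}
    (hlbar : ∀ x, l x ≤ lbar) (hlbar0 : 0 ≤ lbar) [IsMarkovKernel k] [SFinite P0] (n : ℕ) {r : ℝ}
    (hr : 0 < r) {f : E → ℝ≥0∞} (hf : Measurable f) :
    ∫⁻ x, ENNReal.ofReal (l x) * ∫⁻ y, f y ∂(k x) ∂(jumpMarginalN l k P0 n r) ≤
      ENNReal.ofReal (Real.exp (lbar * r) * ((n + 1) / r)) *
        ∫⁻ x, f x ∂(jumpMarginalN l k P0 (n + 1) r) := by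
  set J := ∫⁻ x, ENNReal.ofReal (l x) * ∫⁻ y, f y ∂(k x) ∂(jumpMarginalN l k P0 n r) with hJ
  have key : ENNReal.ofReal (Real.exp (-(lbar * r)) * (r / (n + 1))) * J ≤
      ∫⁻ x, f x ∂(jumpMarginalN l k P0 (n + 1) r) := by
    rw [lintegral_jumpMarginalN_succ hl _ _ hf, ← setLIntegral_congr Ioc_ae_eq_Icc,
      ENNReal.ofReal_mul (Real.exp_nonneg _), ← lintegral_Icc_div_pow n hr, mul_assoc,
      ← lintegral_mul_const _ (by fun_prop), ← lintegral_const_mul' _ _ (by finiteness)]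
    refine setLIntegral_mono' measurableSet_Ioc fun s hs => ?_
    have h1 : ENNReal.ofReal (s / r) ^ n * J ≤
        ∫⁻ x, ENNReal.ofReal (l x) * ∫⁻ y, f y ∂(k x) ∂(jumpMarginalN l k P0 n s) := by
      have h := lintegral_jumpMarginalN_mul_le (k := k) (P0 := P0) hl hl0 (c := r / s)
        ((one_le_div hs.1).2 hs.2) n hs.1.le (measurable_rate_mul_lintegral (k := k) hl hf)
      rw [div_mul_cancel₀ _ hs.1.ne'] at h
      calc _ ≤ ENNReal.ofReal (s / r) ^ n * (ENNReal.ofReal (r / s) ^ n * _) := by gcongr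
        _ = _ := by
          rw [← mul_assoc, ← mul_pow, ← ENNReal.ofReal_mul (by have := hs.1; positivity)]
          have : s / r * (r / s) = 1 := by have := hs.1; field_simp
          simp [this]
    refine (mul_le_mul' le_rfl h1).trans ?_
    rw [← lintegral_const_mul' (ENNReal.ofReal (Real.exp (-(lbar * r)))) _ (by finiteness)]
    refine lintegral_mono fun x => ?_
    rw [mul_left_comm, ← lintegral_const_mul' (ENNReal.ofReal (Real.exp (-(lbar * r)))) _
      (by finiteness)]
    refine mul_le_mul' le_rfl (lintegral_mono fun y => mul_le_mul'
      (ENNReal.ofReal_le_ofReal (Real.exp_le_exp.2 ?_)) le_rfl)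
    have hs' : r - s ≤ r := by linarith [hs.1]
    have := mul_le_mul (hlbar y) hs' (by linarith [hs.2]) hlbar0
    linarith
  calc J = ENNReal.ofReal (Real.exp (lbar * r) * ((n + 1) / r)) *
        (ENNReal.ofReal (Real.exp (-(lbar * r)) * (r / (n + 1))) * J) := by
        rw [← mul_assoc, ← ENNReal.ofReal_mul (by positivity)]
        have : Real.exp (lbar * r) * ((n + 1) / r) * (Real.exp (-(lbar * r)) * (r / (n + 1)))
            = 1 := by
          rw [Real.exp_neg]; field_simp
        simp [this]
    _ ≤ _ := by gcongr

lemma setLIntegral_Icc_pow (n : ℕ) {t : ℝ} (ht : 0 ≤ t) :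
    ∫⁻ s in Set.Icc 0 t, ENNReal.ofReal (s ^ n) = ENNReal.ofReal (t ^ (n + 1) / (n + 1)) := by
  rw [← ofReal_integral_eq_lintegral_ofReal (Continuous.integrableOn_Icc (by fun_prop)),
    integral_Icc_eq_integral_Ioc, ← intervalIntegral.integral_of_le ht, integral_pow]
  · simp
  · filter_upwards [ae_restrict_mem measurableSet_Icc] with s hs
    exact pow_nonneg hs.1 n

lemma jumpMarginalN_univ_le (hl : Measurable l) (hl0 : ∀ x, 0 ≤ l x) {lbar : ℝ}
    (hlbar : ∀ x, l x ≤ lbar) (hlbar0 : 0 ≤ lbar) [IsMarkovKernel k] [IsProbabilityMeasure P0]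
    (n : ℕ) {t : ℝ} (ht : 0 ≤ t) :
    ∫⁻ _, 1 ∂(jumpMarginalN l k P0 n t) ≤ ENNReal.ofReal ((lbar * t) ^ n / n.factorial) := by
  have hdecay : ∀ y, ∀ u : ℝ, 0 ≤ u → ENNReal.ofReal (Real.exp (-(l y) * u)) ≤ 1 := by
    intro y u hu
    rw [ENNReal.ofReal_le_one, Real.exp_le_one_iff]
    nlinarith [hl0 y, mul_nonneg (hl0 y) hu]
  induction n generalizing t with
  | zero =>
    rw [lintegral_jumpMarginalN_zero hl _ measurable_const]
    refine (lintegral_mono fun y => mul_le_mul' (hdecay y t ht) le_rfl).trans ?_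
    simp
  | succ n ih =>
    rw [lintegral_jumpMarginalN_succ hl _ _ measurable_const]
    have hstep : ∀ s ∈ Set.Icc 0 t, ∫⁻ x, ENNReal.ofReal (l x) *
        ∫⁻ y, ENNReal.ofReal (Real.exp (-(l y) * (t - s))) * 1 ∂(k x)
          ∂(jumpMarginalN l k P0 n s) ≤
        ENNReal.ofReal (lbar * (lbar ^ n / n.factorial)) * ENNReal.ofReal (s ^ n) := by
      intro s hs
      calc _ ≤ ∫⁻ x, ENNReal.ofReal lbar * 1 ∂(jumpMarginalN l k P0 n s) := by
            refine lintegral_mono fun x => mul_le_mul' (ENNReal.ofReal_le_ofReal (hlbar x)) ?_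
            refine (lintegral_mono fun y => mul_le_mul'
              (hdecay y (t - s) (by linarith [hs.2])) le_rfl).trans ?_
            simp
        _ = ENNReal.ofReal lbar * ∫⁻ x, 1 ∂(jumpMarginalN l k P0 n s) :=
            lintegral_const_mul' _ _ (by finiteness)
        _ ≤ ENNReal.ofReal lbar * ENNReal.ofReal ((lbar * s) ^ n / n.factorial) := by
            gcongr
            exact ih hs.1
        _ = _ := by
            rw [← ENNReal.ofReal_mul hlbar0, ← ENNReal.ofReal_mul (by positivity)]
            congr 1
            rw [mul_pow]
            ring
    refine (setLIntegral_mono' measurableSet_Icc hstep).trans ?_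
    rw [lintegral_const_mul' _ _ (by finiteness), setLIntegral_Icc_pow n ht,
      ← ENNReal.ofReal_mul (by positivity)]
    refine ENNReal.ofReal_le_ofReal (le_of_eq ?_)
    rw [Nat.factorial_succ]
    push_cast
    field_simp
    ring

lemma ofReal_exp_add_setLIntegral {a : ℝ} (ha : 0 ≤ a) {s t : ℝ} (hst : s ≤ t) :
    ENNReal.ofReal (Real.exp (-a * (t - s))) +
      ∫⁻ u in Set.Icc s t, ENNReal.ofReal (Real.exp (-a * (u - s))) * ENNReal.ofReal a = 1 := by
  have hinteg : ∫ u in s..t, Real.exp (-a * (u - s)) * a = 1 - Real.exp (-a * (t - s)) := by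
    have hderiv : ∀ u ∈ Set.uIcc s t,
        HasDerivAt (fun u => -Real.exp (-a * (u - s))) (Real.exp (-a * (u - s)) * a) u := by
      intro u _
      have h := ((((hasDerivAt_id u).sub_const s).const_mul (-a)).exp).neg
      simpa [Pi.neg_def] using h
    rw [intervalIntegral.integral_eq_sub_of_hasDerivAt hderiv
      (Continuous.intervalIntegrable (by fun_prop) _ _)]
    simp
    ring
  simp_rw [← ENNReal.ofReal_mul (Real.exp_nonneg _)]
  rw [← ofReal_integral_eq_lintegral_ofReal (Continuous.integrableOn_Icc (by fun_prop))
    (Filter.Eventually.of_forall fun u => mul_nonneg (Real.exp_nonneg _) ha),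
    integral_Icc_eq_integral_Ioc, ← intervalIntegral.integral_of_le hst, hinteg,
    ← ENNReal.ofReal_add (Real.exp_nonneg _)]
  · simp
  · rw [sub_nonneg, Real.exp_le_one_iff]
    nlinarith [mul_nonneg ha (sub_nonneg.2 hst)]

lemma setLIntegral_Icc_swap {G : ℝ → ℝ → ℝ≥0∞} (hG : Measurable (Function.uncurry G)) (t : ℝ) :
    ∫⁻ u in Set.Icc 0 t, ∫⁻ s in Set.Icc 0 u, G s u =
      ∫⁻ s in Set.Icc 0 t, ∫⁻ u in Set.Icc s t, G s u := by
  let S : Set (ℝ × ℝ) := {p | 0 ≤ p.1 ∧ p.1 ≤ p.2 ∧ p.2 ≤ t}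
  have hS : MeasurableSet S :=
    (measurableSet_le measurable_const measurable_fst).inter
      ((measurableSet_le measurable_fst measurable_snd).inter
        (measurableSet_le measurable_snd measurable_const))
  have hH : Measurable (S.indicator (Function.uncurry G)) := hG.indicator hS
  have h1 : ∫⁻ u in Set.Icc 0 t, ∫⁻ s in Set.Icc 0 u, G s u =
      ∫⁻ u, ∫⁻ s, S.indicator (Function.uncurry G) (s, u) := by
    rw [← lintegral_indicator measurableSet_Icc]
    refine lintegral_congr fun u => ?_
    by_cases hu : u ∈ Set.Icc 0 t
    · rw [Set.indicator_of_mem hu, ← lintegral_indicator measurableSet_Icc]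
      refine lintegral_congr fun s => ?_
      have hiff : s ∈ Set.Icc 0 u ↔ (s, u) ∈ S :=
        ⟨fun h => ⟨h.1, h.2, hu.2⟩, fun h => ⟨h.1, h.2.1⟩⟩
      by_cases hs : s ∈ Set.Icc 0 u
      · rw [Set.indicator_of_mem hs, Set.indicator_of_mem (hiff.1 hs)]
        rfl
      · rw [Set.indicator_of_notMem hs, Set.indicator_of_notMem (fun h => hs (hiff.2 h))]
    · rw [Set.indicator_of_notMem hu]
      symm
      convert lintegral_zero with s
      exact Set.indicator_of_notMem (fun h => hu ⟨h.1.trans h.2.1, h.2.2⟩) _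
  have h2 : ∫⁻ s in Set.Icc 0 t, ∫⁻ u in Set.Icc s t, G s u =
      ∫⁻ s, ∫⁻ u, S.indicator (Function.uncurry G) (s, u) := by
    rw [← lintegral_indicator measurableSet_Icc]
    refine lintegral_congr fun s => ?_
    by_cases hs : s ∈ Set.Icc 0 t
    · rw [Set.indicator_of_mem hs, ← lintegral_indicator measurableSet_Icc]
      refine lintegral_congr fun u => ?_
      have hiff : u ∈ Set.Icc s t ↔ (s, u) ∈ S :=
        ⟨fun h => ⟨hs.1, h.1, h.2⟩, fun h => ⟨h.2.1, h.2.2⟩⟩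
      by_cases hu : u ∈ Set.Icc s t
      · rw [Set.indicator_of_mem hu, Set.indicator_of_mem (hiff.1 hu)]
        rfl
      · rw [Set.indicator_of_notMem hu, Set.indicator_of_notMem (fun h => hu (hiff.2 h))]
    · rw [Set.indicator_of_notMem hs]
      symm
      convert lintegral_zero with u
      exact Set.indicator_of_notMem (fun h => hs ⟨h.1, h.2.1.trans h.2.2⟩) _
  rw [h1, h2]
  exact lintegral_lintegral_swap (f := fun u s => S.indicator (Function.uncurry G) (s, u))
    (hH.comp measurable_swap).aemeasurable

/-- Mass balance: the `(n+1)`-st jump has occurred before `t` iff exactly `n+1` jumps have, or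
the `(n+2)`-nd has too. -/
lemma jumpMarginalN_mass_balance (hl : Measurable l) (hl0 : ∀ x, 0 ≤ l x)
    [IsMarkovKernel k] [SFinite P0] (n : ℕ) (t : ℝ) :
    ∫⁻ _, 1 ∂(jumpMarginalN l k P0 (n + 1) t) + ∫⁻ s in Set.Icc 0 t,
        ∫⁻ x, ENNReal.ofReal (l x) ∂(jumpMarginalN l k P0 (n + 1) s) =
      ∫⁻ s in Set.Icc 0 t, ∫⁻ x, ENNReal.ofReal (l x) ∂(jumpMarginalN l k P0 n s) := by
  obtain ⟨κ, hsf, hκ⟩ := exists_kernel_eq_jumpMarginalN (P0 := P0) (k := k) hl n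
  set η := jumpFlux l k κ
  have hG : Measurable (Function.uncurry fun s u => ∫⁻ y,
      ENNReal.ofReal (Real.exp (-(l y) * (u - s))) * ENNReal.ofReal (l y) ∂(η s)) := by
    have hF : Measurable (Function.uncurry fun (p : ℝ × ℝ) (y : E) =>
        ENNReal.ofReal (Real.exp (-(l y) * (p.2 - p.1))) * ENNReal.ofReal (l y)) := by
      unfold Function.uncurry
      fun_prop
    exact hF.lintegral_kernel_prod_right (κ := Kernel.prodMkRight ℝ η)
  rw [lintegral_jumpMarginalN_succ_flux hl hκ t measurable_const]
  simp_rw [lintegral_jumpMarginalN_succ_flux hl hκ _ hl.ennreal_ofReal]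
  rw [setLIntegral_Icc_swap hG t, ← lintegral_add_left']
  swap
  · have hF : Measurable (Function.uncurry fun (s : ℝ) (y : E) =>
        ENNReal.ofReal (Real.exp (-(l y) * (t - s))) * 1) := by
      unfold Function.uncurry
      fun_prop
    exact (hF.lintegral_kernel_prod_right (κ := η)).aemeasurable
  refine setLIntegral_congr_fun measurableSet_Icc fun s hs => ?_
  have hswap : ∫⁻ u in Set.Icc s t, ∫⁻ y,
      ENNReal.ofReal (Real.exp (-(l y) * (u - s))) * ENNReal.ofReal (l y) ∂(η s) =
      ∫⁻ y, (∫⁻ u in Set.Icc s t,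
        ENNReal.ofReal (Real.exp (-(l y) * (u - s))) * ENNReal.ofReal (l y)) ∂(η s) := by
    refine lintegral_lintegral_swap (Measurable.aemeasurable ?_)
    unfold Function.uncurry
    fun_prop
  have hm : Measurable fun y => ENNReal.ofReal (Real.exp (-(l y) * (t - s))) * 1 :=
    (measurable_decay hl _).mul_const 1
  rw [hswap, ← lintegral_add_left hm]
  simp_rw [mul_one, ofReal_exp_add_setLIntegral (hl0 _) hs.2]
  rw [lintegral_jumpFlux hl κ s measurable_const, hκ]
  simp

lemma jumpMarginalN_mass_sum (hl : Measurable l) (hl0 : ∀ x, 0 ≤ l x)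
    [IsMarkovKernel k] [IsProbabilityMeasure P0] (n : ℕ) {t : ℝ} (ht : 0 ≤ t) :
    ∑ i ∈ Finset.range (n + 1), ∫⁻ _, 1 ∂(jumpMarginalN l k P0 i t) + ∫⁻ s in Set.Icc 0 t,
        ∫⁻ x, ENNReal.ofReal (l x) ∂(jumpMarginalN l k P0 n s) = 1 := by
  induction n with
  | zero =>
    rw [zero_add, Finset.sum_range_one, lintegral_jumpMarginalN_zero hl _ measurable_const]
    simp_rw [lintegral_jumpMarginalN_zero hl _ hl.ennreal_ofReal]
    rw [lintegral_lintegral_swap, ← lintegral_add_left]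
    · have h := fun y => ofReal_exp_add_setLIntegral (hl0 y) ht
      simp only [sub_zero] at h
      simp_rw [mul_one, h]
      simp
    · exact (measurable_decay hl _).mul_const 1
    · refine Measurable.aemeasurable ?_
      unfold Function.uncurry
      fun_prop
  | succ n ih =>
    rw [Finset.sum_range_succ, add_assoc, jumpMarginalN_mass_balance hl hl0, ih]

lemma isProbabilityMeasure_jumpMarginal (hl : Measurable l) (hl0 : ∀ x, 0 ≤ l x) {lbar : ℝ}
    (hlbar : ∀ x, l x ≤ lbar) (hlbar0 : 0 ≤ lbar) [IsMarkovKernel k] [IsProbabilityMeasure P0]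
    {t : ℝ} (ht : 0 ≤ t) : IsProbabilityMeasure (jumpMarginal l k P0 t) := by
  have hR : ∀ n, ∫⁻ s in Set.Icc 0 t, ∫⁻ x, ENNReal.ofReal (l x) ∂(jumpMarginalN l k P0 n s) ≤
      ENNReal.ofReal (lbar * t * ((lbar * t) ^ n / n.factorial)) := by
    intro n
    have hstep : ∀ s ∈ Set.Icc 0 t, ∫⁻ x, ENNReal.ofReal (l x) ∂(jumpMarginalN l k P0 n s) ≤
        ENNReal.ofReal (lbar * ((lbar * t) ^ n / n.factorial)) := by
      intro s hs
      calc _ ≤ ∫⁻ x, ENNReal.ofReal lbar * 1 ∂(jumpMarginalN l k P0 n s) :=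
            lintegral_mono fun x => by simpa using ENNReal.ofReal_le_ofReal (hlbar x)
        _ = ENNReal.ofReal lbar * ∫⁻ x, 1 ∂(jumpMarginalN l k P0 n s) :=
            lintegral_const_mul' _ _ (by finiteness)
        _ ≤ ENNReal.ofReal lbar * ENNReal.ofReal ((lbar * t) ^ n / n.factorial) := by
            gcongr
            refine (jumpMarginalN_univ_le hl hl0 hlbar hlbar0 n hs.1).trans
              (ENNReal.ofReal_le_ofReal ?_)
            have := hs.2
            have := hs.1
            gcongr
        _ = _ := (ENNReal.ofReal_mul hlbar0).symm
    refine (setLIntegral_mono' measurableSet_Icc hstep).trans ?_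
    rw [setLIntegral_const, Real.volume_Icc, ← ENNReal.ofReal_mul (by positivity)]
    refine ENNReal.ofReal_le_ofReal (le_of_eq ?_)
    ring
  have hR0 : Filter.Tendsto (fun n => ∫⁻ s in Set.Icc 0 t,
      ∫⁻ x, ENNReal.ofReal (l x) ∂(jumpMarginalN l k P0 n s)) Filter.atTop (nhds 0) := by
    have h := ENNReal.tendsto_ofReal ((FloorSemiring.tendsto_pow_div_factorial_atTop
      (lbar * t)).const_mul (lbar * t))
    rw [mul_zero, ENNReal.ofReal_zero] at h
    exact tendsto_of_tendsto_of_tendsto_of_le_of_le tendsto_const_nhds h (fun _ => zero_le) hR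
  have hsum := (Filter.tendsto_add_atTop_iff_nat 1).2 (ENNReal.tendsto_nat_tsum fun i =>
    ∫⁻ _, 1 ∂(jumpMarginalN l k P0 i t))
  have h := hsum.add hR0
  simp_rw [jumpMarginalN_mass_sum hl hl0 _ ht] at h
  refine ⟨?_⟩
  rw [← lintegral_one, lintegral_jumpMarginal]
  simpa using (tendsto_nhds_unique h tendsto_const_nhds)

lemma mul_rpow_le_rpow_add_rpow {α p : ℝ} (hα : 0 ≤ α) (hαp : α < p) (w a : ℝ≥0∞) :
    w * a ^ α ≤ w ^ (p / (p - α)) + a ^ p := by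
  have hpα : 0 < p - α := sub_pos.2 hαp
  rcases le_total w (a ^ (p - α)) with h | h
  · calc w * a ^ α ≤ a ^ (p - α) * a ^ α := by gcongr
      _ = a ^ p := by rw [← ENNReal.rpow_add_of_nonneg _ _ hpα.le hα, sub_add_cancel]
      _ ≤ _ := le_add_self
  · have h1 : a ≤ w ^ (1 / (p - α)) := by
      rw [one_div, ENNReal.le_rpow_inv_iff hpα]
      exact h
    calc w * a ^ α ≤ w ^ (1 : ℝ) * (w ^ (1 / (p - α))) ^ α := by
          rw [ENNReal.rpow_one]
          gcongr
      _ = w ^ (p / (p - α)) := by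
          rw [← ENNReal.rpow_mul, ← ENNReal.rpow_add_of_nonneg _ _ zero_le_one (by positivity)]
          congr 1
          field_simp
          ring
      _ ≤ _ := le_self_add

lemma lintegral_rpow_le_of_isProbabilityMeasure {Ω : Type*} [MeasurableSpace Ω] {μ : Measure Ω}
    [IsProbabilityMeasure μ] {f : Ω → ℝ≥0∞} (hf : Measurable f) {α : ℝ} (hα : 1 ≤ α) :
    (∫⁻ x, f x ∂μ) ^ α ≤ ∫⁻ x, f x ^ α ∂μ := by
  have h := eLpNorm'_le_eLpNorm'_of_exponent_le (μ := μ) zero_lt_one hα hf.aestronglyMeasurable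
  simp only [eLpNorm'_eq_lintegral_enorm, enorm_eq_self, ENNReal.rpow_one, div_one] at h
  rwa [one_div, ENNReal.le_rpow_inv_iff (by linarith)] at h

lemma tsum_ofReal_pow_div_factorial {c : ℝ} (hc : 0 ≤ c) :
    ∑' n : ℕ, ENNReal.ofReal (c ^ n / n.factorial) = ENNReal.ofReal (Real.exp c) := by
  have h := NormedSpace.expSeries_div_hasSum_exp (𝔸 := ℝ) c
  rw [← ENNReal.ofReal_tsum_of_nonneg (fun n => by positivity) h.summable, h.tsum_eq,
    Real.exp_eq_exp_ℝ]

lemma lintegral_weight_mul_rpow_le (hl : Measurable l) (hl0 : ∀ x, 0 ≤ l x) {lbar : ℝ}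
    (hlbar : ∀ x, l x ≤ lbar) (hlbar0 : 0 ≤ lbar) [IsMarkovKernel k] [IsProbabilityMeasure P0]
    {α p : ℝ} (hα : 0 ≤ α) (hαp : α < p) (n : ℕ) {w t : ℝ} (hw : 0 ≤ w) (ht : 0 ≤ t)
    (f : E → ℝ≥0∞) :
    ENNReal.ofReal w * ∫⁻ x, f x ^ α ∂(jumpMarginalN l k P0 n t) ≤
      ENNReal.ofReal (w ^ (p / (p - α)) * ((lbar * t) ^ n / n.factorial)) +
        ∫⁻ x, f x ^ p ∂(jumpMarginalN l k P0 n t) := by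
  have hq : 0 ≤ p / (p - α) := div_nonneg (by linarith) (by linarith)
  rw [← lintegral_const_mul' _ _ (by finiteness)]
  calc _ ≤ ∫⁻ x, (ENNReal.ofReal (w ^ (p / (p - α))) * 1 + f x ^ p)
          ∂(jumpMarginalN l k P0 n t) := by
        refine lintegral_mono fun x => ?_
        rw [mul_one, ← ENNReal.ofReal_rpow_of_nonneg hw hq]
        exact mul_rpow_le_rpow_add_rpow hα hαp _ _
    _ = ENNReal.ofReal (w ^ (p / (p - α))) * ∫⁻ x, 1 ∂(jumpMarginalN l k P0 n t) +
          ∫⁻ x, f x ^ p ∂(jumpMarginalN l k P0 n t) := by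
        rw [lintegral_add_left measurable_const, lintegral_const_mul' _ _ (by finiteness)]
    _ ≤ _ := by
        rw [ENNReal.ofReal_mul (by positivity)]
        gcongr
        exact jumpMarginalN_univ_le hl hl0 hlbar hlbar0 n ht

lemma tsum_pow_mul_lintegral_rpow_le (hl : Measurable l) (hl0 : ∀ x, 0 ≤ l x) {lbar : ℝ}
    (hlbar : ∀ x, l x ≤ lbar) (hlbar0 : 0 ≤ lbar) [IsMarkovKernel k] [IsProbabilityMeasure P0]
    {α p : ℝ} (hα : 0 ≤ α) (hαp : α < p) {w c a b r t : ℝ} (hw : 0 ≤ w) (ha : 0 < a)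
    (hat : a ≤ t) (htb : t ≤ b) (hr : 0 ≤ r) (hc : 1 ≤ c) (hrc : r ≤ c * a)
    {f : E → ℝ≥0∞} (hf : Measurable f) :
    ∑' n, ENNReal.ofReal w ^ n * ∫⁻ x, f x ^ α ∂(jumpMarginalN l k P0 n r) ≤
      ENNReal.ofReal (Real.exp (lbar * b)) *
        (ENNReal.ofReal (Real.exp ((w * c) ^ (p / (p - α)) * (lbar * b))) +
          ∫⁻ x, f x ^ p ∂(jumpMarginal l k P0 t)) := by
  have ht : 0 ≤ t := by linarith
  have hb : 0 ≤ b := by linarith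
  have hwc : 0 ≤ w * c := by positivity
  rw [lintegral_jumpMarginal, ← tsum_ofReal_pow_div_factorial
    (c := (w * c) ^ (p / (p - α)) * (lbar * b)) (by positivity), ← ENNReal.tsum_add,
    ← ENNReal.tsum_mul_left]
  refine ENNReal.tsum_le_tsum fun n => ?_
  calc _ ≤ ENNReal.ofReal w ^ n * (ENNReal.ofReal (Real.exp (lbar * b)) *
          (ENNReal.ofReal c ^ n * ∫⁻ x, f x ^ α ∂(jumpMarginalN l k P0 n t))) :=
        mul_le_mul' le_rfl (lintegral_jumpMarginalN_le hl hl0 hlbar hlbar0 n ha hat htb hr hc hrc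
          (hf.pow_const α))
    _ = ENNReal.ofReal (Real.exp (lbar * b)) * (ENNReal.ofReal ((w * c) ^ n) *
          ∫⁻ x, f x ^ α ∂(jumpMarginalN l k P0 n t)) := by
        rw [mul_pow, ENNReal.ofReal_mul (by positivity), ENNReal.ofReal_pow hw,
          ENNReal.ofReal_pow (by linarith)]
        ring
    _ ≤ _ := by
        refine mul_le_mul' le_rfl ((lintegral_weight_mul_rpow_le hl hl0 hlbar hlbar0 hα hαp n
          (pow_nonneg hwc n) ht f).trans (add_le_add_left (ENNReal.ofReal_le_ofReal ?_) _))
        rw [← Real.rpow_pow_comm hwc, mul_pow _ (lbar * b),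
          mul_div_assoc]
        gcongr

lemma lintegral_rate_jumpMarginal_le (hl : Measurable l) (hl0 : ∀ x, 0 ≤ l x) {lbar : ℝ}
    (hlbar : ∀ x, l x ≤ lbar) (hlbar0 : 0 ≤ lbar) [IsMarkovKernel k] [SFinite P0]
    {b r : ℝ} (hr : 0 < r) (hrb : r ≤ b) {f : E → ℝ≥0∞} (hf : Measurable f) :
    ∫⁻ x, ENNReal.ofReal (l x) * ∫⁻ y, f y ∂(k x) ∂(jumpMarginal l k P0 r) ≤
      ENNReal.ofReal (Real.exp (lbar * b)) * ∑' n : ℕ, ENNReal.ofReal ((n + 1) / r) *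
        ∫⁻ x, f x ∂(jumpMarginalN l k P0 (n + 1) r) := by
  rw [lintegral_jumpMarginal, ← ENNReal.tsum_mul_left]
  refine ENNReal.tsum_le_tsum fun n => ?_
  refine (lintegral_jumpMarginalN_rate_le hl hl0 hlbar hlbar0 n hr hf).trans ?_
  rw [← mul_assoc, ← ENNReal.ofReal_mul (by positivity)]
  refine mul_le_mul' (ENNReal.ofReal_le_ofReal ?_) le_rfl
  gcongr

lemma tsum_succ_div_mul_le {r : ℝ} (hr : 0 < r) (F : ℕ → ℝ≥0∞) :
    ∑' n : ℕ, ENNReal.ofReal ((n + 1) / r) * F (n + 1) ≤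
      ENNReal.ofReal (1 / r) * ∑' n, ENNReal.ofReal 2 ^ n * F n := by
  calc _ ≤ ∑' n : ℕ, ENNReal.ofReal (1 / r) * (ENNReal.ofReal 2 ^ (n + 1) * F (n + 1)) := by
        refine ENNReal.tsum_le_tsum fun n => ?_
        rw [← mul_assoc, ← ENNReal.ofReal_pow zero_le_two, ← ENNReal.ofReal_mul (by positivity)]
        refine mul_le_mul' (ENNReal.ofReal_le_ofReal ?_) le_rfl
        rw [div_eq_inv_mul, one_div]
        gcongr
        exact_mod_cast (Nat.lt_two_pow_self (n := n + 1)).le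
    _ = ENNReal.ofReal (1 / r) * ∑' n : ℕ, ENNReal.ofReal 2 ^ (n + 1) * F (n + 1) :=
        ENNReal.tsum_mul_left
    _ ≤ _ := mul_le_mul' le_rfl (ENNReal.tsum_comp_le_tsum_of_injective
        (add_left_injective 1) fun n => ENNReal.ofReal 2 ^ n * F n)

lemma tsum_succ_div_mul_lintegral_le (hl : Measurable l) (hl0 : ∀ x, 0 ≤ l x) {lbar : ℝ}
    (hlbar : ∀ x, l x ≤ lbar) (hlbar0 : 0 ≤ lbar) [IsMarkovKernel k] [IsProbabilityMeasure P0]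
    {p : ℝ} (hp : 1 < p) {b t : ℝ} (ht : 0 < t) (htb : t ≤ b) (f : E → ℝ≥0∞) :
    ∑' n : ℕ, ENNReal.ofReal ((n + 1) / t) * ∫⁻ x, f x ∂(jumpMarginalN l k P0 (n + 1) t) ≤
      ENNReal.ofReal (t ^ (-(1 / p))) *
        (ENNReal.ofReal (Real.exp (2 ^ (p / (p - 1)) * (lbar * max 1 b))) +
          ∫⁻ x, f x ^ p ∂(jumpMarginal l k P0 t)) := by
  set q := p / (p - 1) with hq
  have hp0 : 0 < p := by linarith
  have hp1 : 0 < p - 1 := by linarith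
  have hq0 : 0 < q := by positivity
  have hpq : -(1 / p) + -(1 / q) = -1 := by
    rw [hq]
    field_simp
    ring
  rw [lintegral_jumpMarginal, ← tsum_ofReal_pow_div_factorial (by positivity), ← ENNReal.tsum_add]
  refine le_trans ?_ (mul_le_mul' le_rfl (ENNReal.tsum_comp_le_tsum_of_injective
    (add_left_injective 1) _))
  rw [← ENNReal.tsum_mul_left]
  refine ENNReal.tsum_le_tsum fun n => ?_
  have hw : ((n : ℝ) + 1) / t = t ^ (-(1 / p)) * ((n + 1) * t ^ (-(1 / q))) := by
    rw [mul_left_comm, ← Real.rpow_add ht, hpq, Real.rpow_neg_one, div_eq_mul_inv]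
  rw [hw, ENNReal.ofReal_mul (by positivity), mul_assoc]
  refine mul_le_mul' le_rfl ?_
  have h := lintegral_weight_mul_rpow_le (k := k) (P0 := P0) hl hl0 hlbar hlbar0 zero_le_one hp
    (n + 1) (w := (n + 1) * t ^ (-(1 / q))) (by positivity) ht.le f
  simp only [ENNReal.rpow_one] at h
  refine h.trans (add_le_add_left (ENNReal.ofReal_le_ofReal ?_) _)
  rw [← hq, Real.mul_rpow (by positivity) (by positivity), ← Real.rpow_mul ht.le,
    show -(1 / q) * q = -1 by field_simp, Real.rpow_neg_one]
  have h2 : ((n : ℝ) + 1) ^ q ≤ (2 ^ q) ^ (n + 1) := by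
    rw [Real.rpow_pow_comm zero_le_two]
    gcongr
    exact_mod_cast (Nat.lt_two_pow_self (n := n + 1)).le
  have h3 : t ^ n ≤ max 1 b ^ (n + 1) :=
    calc t ^ n ≤ max 1 b ^ n := by
          gcongr
          exact htb.trans (le_max_right _ _)
      _ ≤ _ := pow_le_pow_right₀ (le_max_left _ _) n.le_succ
  calc ((n : ℝ) + 1) ^ q * t⁻¹ * ((lbar * t) ^ (n + 1) / (n + 1).factorial)
      = ((n : ℝ) + 1) ^ q * (lbar ^ (n + 1) * t ^ n) / (n + 1).factorial := by
        rw [mul_pow, pow_succ t]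
        field_simp
    _ ≤ (2 ^ q) ^ (n + 1) * (lbar ^ (n + 1) * max 1 b ^ (n + 1)) / (n + 1).factorial := by
        gcongr
    _ = _ := by rw [mul_pow, mul_pow]

lemma lintegral_rate_add_rpow_le {lbar : ℝ} (hlbar : ∀ x, l x ≤ lbar)
    [IsMarkovKernel k] (μ : Measure E) {α : ℝ} (hα : 1 ≤ α) {f : E → ℝ≥0∞} (hf : Measurable f) :
    ∫⁻ x, (ENNReal.ofReal (l x) * (∫⁻ y, f y ∂(k x) + f x)) ^ α ∂μ ≤
      2 ^ (α - 1) * (ENNReal.ofReal lbar ^ (α - 1) *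
          ∫⁻ x, ENNReal.ofReal (l x) * ∫⁻ y, f y ^ α ∂(k x) ∂μ +
        ENNReal.ofReal lbar ^ α * ∫⁻ x, f x ^ α ∂μ) := by
  have hα0 : 0 ≤ α := by linarith
  have hα1 : 0 ≤ α - 1 := by linarith
  have hL : ENNReal.ofReal lbar ^ (α - 1) ≠ ∞ := ENNReal.rpow_ne_top_of_nonneg hα1 (by finiteness)
  have hL' : ENNReal.ofReal lbar ^ α ≠ ∞ := ENNReal.rpow_ne_top_of_nonneg hα0 (by finiteness)
  have h2 : (2 : ℝ≥0∞) ^ (α - 1) ≠ ∞ := ENNReal.rpow_ne_top_of_nonneg hα1 (by finiteness)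
  rw [← lintegral_const_mul' _ _ hL, ← lintegral_const_mul' _ _ hL',
    ← lintegral_add_right _ ((hf.pow_const α).const_mul _), ← lintegral_const_mul' _ _ h2]
  refine lintegral_mono fun x => ?_
  have hlx : ENNReal.ofReal (l x) ≤ ENNReal.ofReal lbar := ENNReal.ofReal_le_ofReal (hlbar x)
  have hlα : ENNReal.ofReal (l x) ^ α ≤ ENNReal.ofReal lbar ^ (α - 1) * ENNReal.ofReal (l x) :=
    calc ENNReal.ofReal (l x) ^ α
        = ENNReal.ofReal (l x) ^ (α - 1) * ENNReal.ofReal (l x) ^ (1 : ℝ) := by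
          rw [← ENNReal.rpow_add_of_nonneg _ _ hα1 zero_le_one, sub_add_cancel]
      _ ≤ _ := by
          rw [ENNReal.rpow_one]
          exact mul_le_mul' (ENNReal.rpow_le_rpow hlx hα1) le_rfl
  calc (ENNReal.ofReal (l x) * (∫⁻ y, f y ∂(k x) + f x)) ^ α
      ≤ ENNReal.ofReal (l x) ^ α *
          (2 ^ (α - 1) * ((∫⁻ y, f y ∂(k x)) ^ α + f x ^ α)) := by
        rw [ENNReal.mul_rpow_of_nonneg _ _ hα0]
        exact mul_le_mul' le_rfl (ENNReal.rpow_add_le_mul_rpow_add_rpow _ _ hα)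
    _ = 2 ^ (α - 1) * (ENNReal.ofReal (l x) ^ α * (∫⁻ y, f y ∂(k x)) ^ α +
          ENNReal.ofReal (l x) ^ α * f x ^ α) := by ring
    _ ≤ 2 ^ (α - 1) * (ENNReal.ofReal lbar ^ (α - 1) * ENNReal.ofReal (l x) *
          ∫⁻ y, f y ^ α ∂(k x) + ENNReal.ofReal lbar ^ α * f x ^ α) :=
        mul_le_mul' le_rfl (add_le_add
          (mul_le_mul' hlα (lintegral_rpow_le_of_isProbabilityMeasure hf hα))
          (mul_le_mul' (ENNReal.rpow_le_rpow hlx hα0) le_rfl))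
    _ = _ := by rw [mul_assoc (ENNReal.ofReal lbar ^ (α - 1))]

end JumpProcess

section Kantorovich

lemma norm_sub_rpow_le {E : Type*} [NormedAddCommGroup E] {ρ : ℝ} (hρ : 0 ≤ ρ) (x y : E) :
    ‖x - y‖ ^ ρ ≤ 2 ^ ρ * (‖x‖ ^ ρ + ‖y‖ ^ ρ) := by
  have h1 : ‖x - y‖ ≤ 2 * max ‖x‖ ‖y‖ := by
    linarith [norm_sub_le x y, le_max_left ‖x‖ ‖y‖, le_max_right ‖x‖ ‖y‖]
  calc ‖x - y‖ ^ ρ ≤ (2 * max ‖x‖ ‖y‖) ^ ρ := by gcongr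
    _ = 2 ^ ρ * (max ‖x‖ ‖y‖) ^ ρ := Real.mul_rpow (by norm_num) (by positivity)
    _ ≤ _ := by
      gcongr
      rcases max_cases ‖x‖ ‖y‖ with ⟨h, -⟩ | ⟨h, -⟩ <;> rw [h]
      · linarith [Real.rpow_nonneg (norm_nonneg y) ρ]
      · linarith [Real.rpow_nonneg (norm_nonneg x) ρ]

variable {E : Type*} [MeasurableSpace E] [NormedAddCommGroup E]

lemma wassersteinPow_nonneg (ρ : ℝ) (P Q : Measure E) : 0 ≤ wassersteinPow ρ P Q := by
  refine Real.sInf_nonneg ?_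
  rintro c ⟨π, -, rfl⟩
  exact integral_nonneg fun p => by positivity

lemma exists_coupling_lt (ρ : ℝ) (P Q : Measure E) [IsProbabilityMeasure P]
    [IsProbabilityMeasure Q] {η : ℝ} (hη : 0 < η) :
    ∃ π : Measure (E × E), IsCoupling π P Q ∧
      ∫ p, ‖p.1 - p.2‖ ^ ρ ∂π < wassersteinPow ρ P Q + η := by
  have hne : {c : ℝ | ∃ π : Measure (E × E), IsCoupling π P Q ∧
      c = ∫ p, ‖p.1 - p.2‖ ^ ρ ∂π}.Nonempty :=
    ⟨_, P.prod Q, ⟨by simp [Measure.map_fst_prod], by simp [Measure.map_snd_prod]⟩, rfl⟩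
  obtain ⟨c, ⟨π, hπ, rfl⟩, hc⟩ := exists_lt_of_csInf_lt hne (lt_add_of_pos_right _ hη)
  exact ⟨π, hπ, hc⟩

lemma IsKantorovichPair.nonneg {ρ : ℝ} {P Q : Measure E} {ψ ψt : E → ℝ}
    (h : IsKantorovichPair ρ P Q ψ ψt) (x y : E) : 0 ≤ ‖x - y‖ ^ ρ + ψ x + ψt y := by
  obtain ⟨-, -, h1, h2, -⟩ := h
  by_cases hx : BddBelow (Set.range fun y : E => ‖x - y‖ ^ ρ + ψt y)
  · have := ciInf_le hx y
    have := h1 x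
    linarith
  by_cases hy : BddBelow (Set.range fun x : E => ‖x - y‖ ^ ρ + ψ x)
  · have := ciInf_le hy x
    have := h2 y
    linarith
  have hx0 : ψ x = 0 := by rw [h1 x, Real.iInf_of_not_bddBelow hx, neg_zero]
  have hy0 : ψt y = 0 := by rw [h2 y, Real.iInf_of_not_bddBelow hy, neg_zero]
  rw [hx0, hy0]
  positivity

lemma IsKantorovichPair.measurable [BorelSpace E] {ρ : ℝ} (hρ : 0 ≤ ρ) {P Q : Measure E}
    {ψ ψt : E → ℝ} (h : IsKantorovichPair ρ P Q ψ ψt) : Measurable ψ := by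
  have heq : ψ = fun x => - ⨅ y : E, (‖x - y‖ ^ ρ + ψt y) := funext h.2.2.1
  rw [heq]
  refine (UpperSemicontinuous.measurable ?_).neg
  refine upperSemicontinuous_ciInf (fun x => ⟨-ψ x, ?_⟩) fun y => Continuous.upperSemicontinuous ?_
  · rintro _ ⟨y, rfl⟩
    have := h.nonneg x y
    dsimp only
    linarith
  · exact ((continuous_id.sub continuous_const).norm.rpow_const fun _ => Or.inr hρ).add
      continuous_const

lemma integrable_norm_rpow_of_lintegral_le [BorelSpace E] {ρ p : ℝ} (hp : 1 ≤ p)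
    {P : Measure E} [IsProbabilityMeasure P] {M : ℝ} (hM : 0 ≤ M)
    (hP : ∫⁻ x, ENNReal.ofReal (‖x‖ ^ (ρ * p)) ∂P ≤ ENNReal.ofReal M) :
    Integrable (fun x => ‖x‖ ^ ρ) P ∧ ∫ x, ‖x‖ ^ ρ ∂P ≤ 1 + M := by
  have hle : ∫⁻ x, ENNReal.ofReal (‖x‖ ^ ρ) ∂P ≤ ENNReal.ofReal (1 + M) := by
    calc _ ≤ ∫⁻ x, (1 + ENNReal.ofReal (‖x‖ ^ (ρ * p))) ∂P := by
          refine lintegral_mono fun x => ?_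
          rw [← ENNReal.ofReal_one, ← ENNReal.ofReal_add zero_le_one (by positivity)]
          refine ENNReal.ofReal_le_ofReal ?_
          rw [Real.rpow_mul (norm_nonneg x)]
          rcases le_total (‖x‖ ^ ρ) 1 with h | h
          · have : 0 ≤ (‖x‖ ^ ρ) ^ p := by positivity
            linarith
          · have := Real.self_le_rpow_of_one_le h hp
            linarith
      _ = 1 + ∫⁻ x, ENNReal.ofReal (‖x‖ ^ (ρ * p)) ∂P := by
          rw [lintegral_add_left measurable_const]
          simp
      _ ≤ 1 + ENNReal.ofReal M := by gcongr
      _ = _ := by rw [ENNReal.ofReal_add zero_le_one hM, ENNReal.ofReal_one]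
  have hmeas : AEStronglyMeasurable (fun x : E => ‖x‖ ^ ρ) P :=
    (measurable_norm.pow_const ρ).aestronglyMeasurable
  have hinteg : Integrable (fun x => ‖x‖ ^ ρ) P := by
    refine ⟨hmeas, ?_⟩
    rw [hasFiniteIntegral_iff_ofReal (Filter.Eventually.of_forall fun x => by positivity)]
    exact hle.trans_lt ENNReal.ofReal_lt_top
  refine ⟨hinteg, ?_⟩
  rw [← ofReal_integral_eq_lintegral_ofReal hinteg
    (Filter.Eventually.of_forall fun x => by positivity)] at hle
  exact (ENNReal.ofReal_le_ofReal_iff (by positivity)).1 hle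

lemma integrable_norm_sub_rpow [BorelSpace E] [SecondCountableTopology E] {ρ : ℝ} (hρ : 0 ≤ ρ)
    {Ω : Type*} [MeasurableSpace Ω] {μ : Measure Ω} {X Y : Ω → E} (hX : Measurable X)
    (hY : Measurable Y) (hXi : Integrable (fun ω => ‖X ω‖ ^ ρ) μ)
    (hYi : Integrable (fun ω => ‖Y ω‖ ^ ρ) μ) : Integrable (fun ω => ‖X ω - Y ω‖ ^ ρ) μ := by
  refine ((hXi.add hYi).const_mul (2 ^ ρ)).mono'
    ((hX.sub hY).norm.pow_const ρ).aestronglyMeasurable (Filter.Eventually.of_forall fun ω => ?_)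
  rw [Real.norm_of_nonneg (by positivity)]
  exact norm_sub_rpow_le hρ _ _

/-- Integrating `ψ x + ψt y ≥ -‖x - y‖ ^ ρ` over `x`. -/
lemma neg_le_of_nonneg_integral [BorelSpace E] [SecondCountableTopology E] {ρ A : ℝ} (hρ : 0 ≤ ρ)
    {P : Measure E} [IsProbabilityMeasure P] {ψ : E → ℝ} (hψ : Integrable ψ P)
    (hinteg : Integrable (fun x => ‖x‖ ^ ρ) P) (hA : ∫ x, ‖x‖ ^ ρ ∂P ≤ A) (y : E) (c : ℝ)
    (h : ∀ x, 0 ≤ ‖x - y‖ ^ ρ + ψ x + c) :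
    -(∫ x, ψ x ∂P) - 2 ^ ρ * (A + ‖y‖ ^ ρ) ≤ c := by
  have hi : Integrable (fun x => 2 ^ ρ * (‖x‖ ^ ρ + ‖y‖ ^ ρ)) P :=
    (hinteg.add (integrable_const _)).const_mul _
  have h0 : 0 ≤ ∫ x, (2 ^ ρ * (‖x‖ ^ ρ + ‖y‖ ^ ρ) + ψ x + c) ∂P :=
    integral_nonneg fun x => (h x).trans (by
      have := norm_sub_rpow_le hρ x y
      linarith)
  have hi' : Integrable (fun x => 2 ^ ρ * (‖x‖ ^ ρ + ‖y‖ ^ ρ) + ψ x) P := hi.add hψ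
  rw [integral_add hi' (integrable_const _), integral_add hi hψ, integral_const_mul,
    integral_add hinteg (integrable_const _)] at h0
  simp only [integral_const, probReal_univ, smul_eq_mul, one_mul] at h0
  have : (2 : ℝ) ^ ρ * (∫ x, ‖x‖ ^ ρ ∂P + ‖y‖ ^ ρ) ≤ 2 ^ ρ * (A + ‖y‖ ^ ρ) := by gcongr
  linarith

lemma min_rpow_le {u F G K : ℝ≥0∞} {p : ℝ} (hp : 1 ≤ p) (h : u ≤ F + G) :
    (min u K) ^ p ≤ 2 ^ (p - 1) * (K ^ (p - 1) * F + G ^ p) := by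
  have h1 : min u K ≤ min F K + G := by
    rcases le_total F K with hF | hF
    · rw [min_eq_left hF]
      exact (min_le_left _ _).trans h
    · rw [min_eq_right hF]
      exact (min_le_right _ _).trans le_self_add
  calc (min u K) ^ p ≤ (min F K + G) ^ p := by gcongr
    _ ≤ 2 ^ (p - 1) * ((min F K) ^ p + G ^ p) := ENNReal.rpow_add_le_mul_rpow_add_rpow _ _ hp
    _ ≤ _ := by
      gcongr
      calc (min F K) ^ p = (min F K) ^ (p - 1) * (min F K) ^ (1 : ℝ) := by
            rw [← ENNReal.rpow_add_of_nonneg _ _ (by linarith) (by norm_num)]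
            simp
        _ ≤ _ := by
            rw [ENNReal.rpow_one]
            gcongr
            · exact min_le_right _ _
            · exact min_le_left _ _

lemma lintegral_rpow_le_of_min_le {Ω : Type*} [MeasurableSpace Ω] {μ : Measure Ω} {u : Ω → ℝ≥0∞}
    (hu : Measurable u) (hfin : ∀ x, u x ≠ ∞) {p : ℝ} (hp : 0 ≤ p) {C : ℝ≥0∞}
    (h : ∀ K : ℕ, ∫⁻ x, (min (u x) K) ^ p ∂μ ≤ C) : ∫⁻ x, u x ^ p ∂μ ≤ C := by
  have hmono : Monotone fun (K : ℕ) x => (min (u x) K) ^ p := by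
    intro K L hKL x
    dsimp only
    gcongr
  calc ∫⁻ x, u x ^ p ∂μ ≤ ∫⁻ x, ⨆ K : ℕ, (min (u x) K) ^ p ∂μ := by
        refine lintegral_mono fun x => ?_
        obtain ⟨K, hK⟩ := ENNReal.exists_nat_gt (hfin x)
        refine le_iSup_of_le K ?_
        rw [min_eq_left hK.le]
    _ = ⨆ K : ℕ, ∫⁻ x, (min (u x) K) ^ p ∂μ :=
        lintegral_iSup (fun K => (hu.min measurable_const).pow_const p) hmono
    _ ≤ C := iSup_le h

/-- Centered Kantorovich potentials have a `p`-th moment controlled by the `ρ * p`-th moments of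
the marginals. -/
lemma exists_lintegral_kantorovich_rpow_le [BorelSpace E] [SecondCountableTopology E] {ρ p M : ℝ}
    (hρ : 0 ≤ ρ) (hp : 1 ≤ p) (hM : 0 ≤ M) :
    ∃ C : ℝ≥0∞, C ≠ ∞ ∧ ∀ (P Q : Measure E) [IsProbabilityMeasure P] [IsProbabilityMeasure Q]
      (ψ ψt : E → ℝ), IsKantorovichPair ρ P Q ψ ψt →
      ∫⁻ x, ENNReal.ofReal (‖x‖ ^ (ρ * p)) ∂P ≤ ENNReal.ofReal M →
      ∫⁻ x, ENNReal.ofReal (‖x‖ ^ (ρ * p)) ∂Q ≤ ENNReal.ofReal M →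
      ∫⁻ x, ENNReal.ofReal |ψ x - ∫ z, ψ z ∂P| ^ p ∂P ≤ C := by
  set A := 1 + M with hA
  set a : ℝ≥0∞ := 2 ^ (p - 1) with ha
  have ha_top : a ≠ ∞ := ENNReal.rpow_ne_top_of_nonneg (by linarith) (by norm_num)
  set D : ℝ≥0∞ := ENNReal.ofReal ((2 ^ ρ) ^ p) *
    (a * (a * (ENNReal.ofReal M + ENNReal.ofReal M) + ENNReal.ofReal ((2 * A) ^ p))) with hD
  refine ⟨a * D, by rw [hD]; finiteness, ?_⟩
  intro P Q _ _ ψ ψt hK hP hQ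
  obtain ⟨hPi, hPA⟩ := integrable_norm_rpow_of_lintegral_le hp hM hP
  obtain ⟨hQi, hQA⟩ := integrable_norm_rpow_of_lintegral_le hp hM hQ
  set m := ∫ z, ψ z ∂P with hm
  have hW := hK.2.2.2.2
  have hW0 := wassersteinPow_nonneg ρ P Q
  have hψm : Measurable ψ := hK.measurable hρ
  have hψt_low : ∀ y, -m - 2 ^ ρ * (A + ‖y‖ ^ ρ) ≤ ψt y := fun y =>
    neg_le_of_nonneg_integral hρ hK.1 hPi hPA y _ fun x => hK.nonneg x y
  have hψ_low : ∀ x, -(∫ z, ψt z ∂Q) - 2 ^ ρ * (A + ‖x‖ ^ ρ) ≤ ψ x := fun x =>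
    neg_le_of_nonneg_integral hρ hK.2.1 hQi hQA x _ fun y => by
      have := hK.nonneg x y
      rw [norm_sub_rev] at this
      linarith
  let f : E × E → ℝ := fun q => ‖q.1 - q.2‖ ^ ρ + ψ q.1 + ψt q.2
  let G : E × E → ℝ≥0∞ := fun q =>
    ENNReal.ofReal (2 ^ ρ * (‖q.1‖ ^ ρ + ‖q.2‖ ^ ρ + 2 * A))
  let u : E → ℝ≥0∞ := fun x => ENNReal.ofReal |ψ x - m|
  have hu : Measurable u := (hψm.sub_const m).abs.ennreal_ofReal
  have hpoint : ∀ q : E × E, u q.1 ≤ ENNReal.ofReal (f q) + G q := by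
    intro q
    have hf0 : 0 ≤ f q := hK.nonneg q.1 q.2
    have hρ2 : 0 ≤ (2 : ℝ) ^ ρ := by positivity
    have h1 := hψ_low q.1
    have h2 := hψt_low q.2
    have hq1 : 0 ≤ (2 : ℝ) ^ ρ * ‖q.1‖ ^ ρ := by positivity
    have hq2 : 0 ≤ (2 : ℝ) ^ ρ * ‖q.2‖ ^ ρ := by positivity
    have hA0 : 0 ≤ (2 : ℝ) ^ ρ * A := by positivity
    have hd : 0 ≤ ‖q.1 - q.2‖ ^ ρ := by positivity
    rw [← ENNReal.ofReal_add hf0 (by positivity)]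
    refine ENNReal.ofReal_le_ofReal (abs_le.2 ⟨?_, ?_⟩)
    · linarith
    · have : f q = ‖q.1 - q.2‖ ^ ρ + ψ q.1 + ψt q.2 := rfl
      linarith
  have hGp : ∀ q, G q ^ p ≤ ENNReal.ofReal ((2 ^ ρ) ^ p) *
      (a * (a * (ENNReal.ofReal (‖q.1‖ ^ (ρ * p)) + ENNReal.ofReal (‖q.2‖ ^ (ρ * p))) +
        ENNReal.ofReal ((2 * A) ^ p))) := by
    intro q
    have hp0 : 0 ≤ p := by linarith
    simp only [G]
    rw [ENNReal.ofReal_mul (by positivity), ENNReal.mul_rpow_of_nonneg _ _ hp0,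
      ENNReal.ofReal_rpow_of_nonneg (by positivity) hp0,
      ENNReal.ofReal_add (by positivity) (by positivity),
      ENNReal.ofReal_add (by positivity) (by positivity), Real.rpow_mul (by positivity),
      Real.rpow_mul (by positivity)]
    simp_rw [← ENNReal.ofReal_rpow_of_nonneg (Real.rpow_nonneg (norm_nonneg _) ρ) hp0]
    rw [← ENNReal.ofReal_rpow_of_nonneg (show 0 ≤ 2 * A by positivity) hp0]
    refine mul_le_mul' le_rfl ?_
    refine (ENNReal.rpow_add_le_mul_rpow_add_rpow _ _ hp).trans ?_
    gcongr
    exact ENNReal.rpow_add_le_mul_rpow_add_rpow _ _ hp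
  refine lintegral_rpow_le_of_min_le hu (fun _ => ENNReal.ofReal_ne_top) (by linarith) fun K => ?_
  have hη : ∀ η : NNReal, 0 < η → ∫⁻ x, (min (u x) K) ^ p ∂P ≤
      a * ((K : ℝ≥0∞) ^ (p - 1) * η + D) := by
    intro η hη
    obtain ⟨π, ⟨hπ1, hπ2⟩, hlt⟩ := exists_coupling_lt ρ P Q (η := η) hη
    have hπprob : IsProbabilityMeasure π := ⟨by
      rw [← Set.preimage_univ (f := (Prod.fst : E × E → E)),
        ← Measure.map_apply measurable_fst MeasurableSet.univ, hπ1, measure_univ]⟩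
    have hi1 : ∀ g : E → ℝ, Integrable g P → Integrable (fun q : E × E => g q.1) π :=
      fun g hg => (hπ1 ▸ hg).comp_measurable measurable_fst
    have hi2 : ∀ g : E → ℝ, Integrable g Q → Integrable (fun q : E × E => g q.2) π :=
      fun g hg => (hπ2 ▸ hg).comp_measurable measurable_snd
    have hd : Integrable (fun q : E × E => ‖q.1 - q.2‖ ^ ρ) π :=
      integrable_norm_sub_rpow hρ measurable_fst measurable_snd (hi1 _ hPi) (hi2 _ hQi)
    have hd' : Integrable (fun q : E × E => ‖q.1 - q.2‖ ^ ρ + ψ q.1) π := hd.add (hi1 _ hK.1)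
    have hfi : Integrable f π := hd'.add (hi2 _ hK.2.1)
    have hF : ∫⁻ q, ENNReal.ofReal (f q) ∂π ≤ η := by
      rw [← ofReal_integral_eq_lintegral_ofReal hfi
        (Filter.Eventually.of_forall fun q => hK.nonneg q.1 q.2)]
      have e1 : ∫ q, ψ q.1 ∂π = ∫ x, ψ x ∂P := by
        rw [← hπ1, integral_map measurable_fst.aemeasurable hψm.aestronglyMeasurable]
      have e2 : ∫ q, ψt q.2 ∂π = ∫ y, ψt y ∂Q := by
        rw [← hπ2, integral_map measurable_snd.aemeasurable
          (by rw [hπ2]; exact hK.2.1.aestronglyMeasurable)]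
      have : ∫ q, f q ∂π ≤ η := by
        simp only [f]
        rw [integral_add hd' (hi2 _ hK.2.1), integral_add hd (hi1 _ hK.1), e1, e2]
        linarith
      exact (ENNReal.ofReal_le_ofReal this).trans (by simp)
    have hm1 : ∀ g : E → ℝ≥0∞, Measurable g → ∫⁻ q, g q.1 ∂π = ∫⁻ x, g x ∂P := fun g hg => by
      rw [← hπ1, lintegral_map hg measurable_fst]
    have hm2 : ∀ g : E → ℝ≥0∞, Measurable g → ∫⁻ q, g q.2 ∂π = ∫⁻ x, g x ∂Q := fun g hg => by
      rw [← hπ2, lintegral_map hg measurable_snd]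
    have hnm : Measurable fun x : E => ENNReal.ofReal (‖x‖ ^ (ρ * p)) :=
      (measurable_norm.pow_const _).ennreal_ofReal
    have hGint : ∫⁻ q, G q ^ p ∂π ≤ D := by
      refine (lintegral_mono hGp).trans ?_
      rw [lintegral_const_mul' _ _ (by finiteness), lintegral_const_mul' _ _ ha_top,
        lintegral_add_right _ measurable_const, lintegral_const_mul' _ _ ha_top,
        lintegral_add_left (f := fun q : E × E => ENNReal.ofReal (‖q.1‖ ^ (ρ * p)))
          (hnm.comp measurable_fst), hm1 _ hnm, hm2 _ hnm, lintegral_const,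
        measure_univ, mul_one, hD]
      gcongr
    have hGm : Measurable fun q => G q ^ p := by
      refine Measurable.pow_const (Measurable.ennreal_ofReal ?_) p
      exact (((measurable_fst.norm.pow_const ρ).add (measurable_snd.norm.pow_const ρ)).add_const
        _).const_mul _
    rw [← hm1 _ ((hu.min measurable_const).pow_const p)]
    refine (lintegral_mono fun q => min_rpow_le hp (hpoint q)).trans ?_
    rw [lintegral_const_mul' _ _ ha_top, lintegral_add_right _ hGm,
      lintegral_const_mul' _ _ (ENNReal.rpow_ne_top_of_nonneg (by linarith) (by simp))]
    gcongr
  have hKtop : (K : ℝ≥0∞) ^ (p - 1) ≠ ∞ := ENNReal.rpow_ne_top_of_nonneg (by linarith) (by simp)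
  have hlim : Filter.Tendsto (fun η : NNReal => a * ((K : ℝ≥0∞) ^ (p - 1) * η + D))
      (nhdsWithin 0 (Set.Ioi 0)) (nhds (a * ((K : ℝ≥0∞) ^ (p - 1) * (0 : NNReal) + D))) := by
    refine Filter.Tendsto.mono_left ?_ nhdsWithin_le_nhds
    refine ENNReal.Tendsto.const_mul (Filter.Tendsto.add ?_ tendsto_const_nhds) (Or.inr ha_top)
    exact ENNReal.Tendsto.const_mul (ENNReal.tendsto_coe.2 Filter.tendsto_id) (Or.inr hKtop)
  have := ge_of_tendsto hlim (by
    filter_upwards [self_mem_nhdsWithin] with η h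
    exact hη η h)
  simpa using this

end Kantorovich

/-- integrability properties of the Kantorovich potentials with respect to the
marginals of pure jump processes: for every `δ ∈ [0,ε)`,
(a) `(t,r) ↦ ∫ |ψ_t - P_t(ψ_t)|^{1+δ} dP_r` is locally bounded on `(0,∞)×[0,∞)`;
(b) `(t,r) ↦ ∫ (∫ λ(x)k(x,dy)|ψ_t(y)-ψ_t(x)|)^{1+δ} P_r(dx)` is locally bounded on `(0,∞)²`;
(c) `t ↦ ∫∫ λ(x)k(x,dy)|ψ_t(y)-ψ_t(x)| P_t(dx)` is locally integrable on `[0,∞)`. -/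
theorem stmt6 (d : ℕ) (ρ : ℝ) (hρ : 1 ≤ ρ)
    (l lt : EuclideanSpace ℝ (Fin d) → ℝ)
    (k kt : Kernel (EuclideanSpace ℝ (Fin d)) (EuclideanSpace ℝ (Fin d)))
    [IsMarkovKernel k] [IsMarkovKernel kt]
    (hl : Measurable l) (hlt : Measurable lt)
    (hl0 : ∀ x, 0 ≤ l x) (hlt0 : ∀ x, 0 ≤ lt x)
    (lbar : ℝ) (hlbar : ∀ x, max (l x) (lt x) ≤ lbar)
    (hnofake : ∀ x, ENNReal.ofReal (l x) * k x {x} = 0)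
    (hnofaket : ∀ x, ENNReal.ofReal (lt x) * kt x {x} = 0)
    (P0 Pt0 : Measure (EuclideanSpace ℝ (Fin d)))
    [IsProbabilityMeasure P0] [IsProbabilityMeasure Pt0]
    (ε : ℝ) (hε : 0 < ε)
    (hmom : ∀ b : ℝ, ∃ M : ℝ, ∀ t ∈ Set.Icc (0:ℝ) b,
      (∫⁻ x, ENNReal.ofReal (‖x‖ ^ (ρ * (1 + ε))) ∂(jumpMarginal l k P0 t))
        + (∫⁻ x, ENNReal.ofReal (‖x‖ ^ (ρ * (1 + ε))) ∂(jumpMarginal lt kt Pt0 t))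
        ≤ ENNReal.ofReal M)
    (ψ ψt : ℝ → EuclideanSpace ℝ (Fin d) → ℝ)
    (hK : ∀ t : ℝ, 0 ≤ t →
      IsKantorovichPair ρ (jumpMarginal l k P0 t) (jumpMarginal lt kt Pt0 t) (ψ t) (ψt t))
    (δ : ℝ) (hδ0 : 0 ≤ δ) (hδε : δ < ε) :
    -- (a)
    (∀ a b a' b' : ℝ, 0 < a → 0 ≤ a' → ∃ M : ℝ,
      ∀ t ∈ Set.Icc a b, ∀ r ∈ Set.Icc a' b',
        ∫⁻ x, ENNReal.ofReal
            (|ψ t x - ∫ z, ψ t z ∂(jumpMarginal l k P0 t)| ^ (1 + δ))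
          ∂(jumpMarginal l k P0 r) ≤ ENNReal.ofReal M) ∧
    -- (b)
    (∀ a b a' b' : ℝ, 0 < a → 0 < a' → ∃ M : ℝ,
      ∀ t ∈ Set.Icc a b, ∀ r ∈ Set.Icc a' b',
        ∫⁻ x, (ENNReal.ofReal (l x) *
            ∫⁻ y, ENNReal.ofReal |ψ t y - ψ t x| ∂(k x)) ^ (1 + δ)
          ∂(jumpMarginal l k P0 r) ≤ ENNReal.ofReal M) ∧
    -- (c)
    (∀ b : ℝ, ∫⁻ t in Set.Icc (0:ℝ) b,
        (∫⁻ x, ENNReal.ofReal (l x) * ∫⁻ y, ENNReal.ofReal |ψ t y - ψ t x| ∂(k x)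
          ∂(jumpMarginal l k P0 t)) ∂volume < ⊤) := by
  have hlb : ∀ x, l x ≤ lbar := fun x => (le_max_left _ _).trans (hlbar x)
  have hltb : ∀ x, lt x ≤ lbar := fun x => (le_max_right _ _).trans (hlbar x)
  have hlbar0 : 0 ≤ lbar := (hl0 0).trans (hlb 0)
  have hρ0 : 0 ≤ ρ := by linarith
  have hα : 1 ≤ 1 + δ := by linarith
  have hα0 : 0 ≤ 1 + δ := by linarith
  have hαp : 1 + δ < 1 + ε := by linarith
  let φ : ℝ → EuclideanSpace ℝ (Fin d) → ℝ≥0∞ := fun t x =>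
    ENNReal.ofReal |ψ t x - ∫ z, ψ t z ∂(jumpMarginal l k P0 t)|
  have hφ : ∀ t, 0 ≤ t → Measurable (φ t) := fun t ht =>
    (((hK t ht).measurable hρ0).sub_const _).abs.ennreal_ofReal
  have hmoment : ∀ b : ℝ, ∃ C : ℝ≥0∞, C ≠ ∞ ∧ ∀ t ∈ Set.Icc 0 b,
      ∫⁻ x, φ t x ^ (1 + ε) ∂(jumpMarginal l k P0 t) ≤ C := by
    intro b
    obtain ⟨M, hM⟩ := hmom b
    obtain ⟨C, hC, h⟩ := exists_lintegral_kantorovich_rpow_le (E := EuclideanSpace ℝ (Fin d)) hρ0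
      (show 1 ≤ 1 + ε by linarith) (le_max_right M 0)
    refine ⟨C, hC, fun t ht => ?_⟩
    have := isProbabilityMeasure_jumpMarginal (k := k) (P0 := P0) hl hl0 hlb hlbar0 ht.1
    have := isProbabilityMeasure_jumpMarginal (k := kt) (P0 := Pt0) hlt hlt0 hltb hlbar0 ht.1
    have hM' := (hM t ht).trans (ENNReal.ofReal_le_ofReal (le_max_left M 0))
    exact h _ _ _ _ (hK t ht.1) (le_self_add.trans hM') (le_add_self.trans hM')
  have hosc : ∀ t, 0 ≤ t → ∀ x, ∫⁻ y, ENNReal.ofReal |ψ t y - ψ t x| ∂(k x) ≤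
      ∫⁻ y, φ t y ∂(k x) + φ t x := by
    intro t ht x
    calc _ ≤ ∫⁻ y, (φ t y + φ t x) ∂(k x) := by
          refine lintegral_mono fun y => ?_
          rw [← ENNReal.ofReal_add (abs_nonneg _) (abs_nonneg _)]
          refine ENNReal.ofReal_le_ofReal ?_
          rw [abs_sub_comm (ψ t x)]
          exact abs_sub_le _ _ _
      _ = _ := by
          rw [lintegral_add_right _ measurable_const]
          simp
  have hbound : ∀ a b b' w : ℝ, 0 < a → 0 ≤ w → ∃ K : ℝ≥0∞, K ≠ ∞ ∧ ∀ t ∈ Set.Icc a b,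
      ∀ r ∈ Set.Icc 0 b', ∑' n, ENNReal.ofReal w ^ n *
        ∫⁻ x, φ t x ^ (1 + δ) ∂(jumpMarginalN l k P0 n r) ≤ K := by
    intro a b b' w ha hw
    obtain ⟨C, hC, hCb⟩ := hmoment b
    refine ⟨ENNReal.ofReal (Real.exp (lbar * b)) * (ENNReal.ofReal (Real.exp
      ((w * max 1 (b' / a)) ^ ((1 + ε) / (1 + ε - (1 + δ))) * (lbar * b))) + C),
      by finiteness, fun t ht r hr => ?_⟩
    have ht0 : 0 ≤ t := ha.le.trans ht.1
    have hrc : r ≤ max 1 (b' / a) * a :=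
      calc r ≤ b' / a * a := by
            rw [div_mul_cancel₀ _ ha.ne']
            exact hr.2
        _ ≤ _ := by
            gcongr
            exact le_max_right _ _
    exact (tsum_pow_mul_lintegral_rpow_le hl hl0 hlb hlbar0 hα0 hαp hw ha ht.1 ht.2 hr.1
      (le_max_left _ _) hrc (hφ t ht0)).trans
        (mul_le_mul' le_rfl (add_le_add_right (hCb t ⟨ht0, ht.2⟩) _))
  have hbound_one : ∀ a b b' : ℝ, 0 < a → ∃ K : ℝ≥0∞, K ≠ ∞ ∧ ∀ t ∈ Set.Icc a b,
      ∀ r ∈ Set.Icc 0 b', ∫⁻ x, φ t x ^ (1 + δ) ∂(jumpMarginal l k P0 r) ≤ K := by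
    intro a b b' ha
    obtain ⟨K, hK, h⟩ := hbound a b b' 1 ha zero_le_one
    refine ⟨K, hK, fun t ht r hr => ?_⟩
    rw [lintegral_jumpMarginal]
    simpa using h t ht r hr
  refine ⟨fun a b a' b' ha ha' => ?_, fun a b a' b' ha ha' => ?_, fun b => ?_⟩
  · obtain ⟨K, hKtop, h⟩ := hbound_one a b b' ha
    refine ⟨K.toReal, fun t ht r hr => ?_⟩
    rw [ENNReal.ofReal_toReal hKtop]
    simp_rw [← ENNReal.ofReal_rpow_of_nonneg (abs_nonneg _) hα0]
    exact h t ht r ⟨ha'.trans hr.1, hr.2⟩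
  · obtain ⟨K, hKtop, h⟩ := hbound_one a b b' ha
    obtain ⟨K₂, hK₂top, h₂⟩ := hbound a b b' 2 ha zero_le_two
    set B : ℝ≥0∞ := 2 ^ (1 + δ - 1) * (ENNReal.ofReal lbar ^ (1 + δ - 1) *
      (ENNReal.ofReal (Real.exp (lbar * b')) * (ENNReal.ofReal (1 / a') * K₂)) +
        ENNReal.ofReal lbar ^ (1 + δ) * K) with hB
    have hδ1 : 0 ≤ 1 + δ - 1 := by linarith
    have hBtop : B ≠ ∞ := by
      rw [hB]
      finiteness
    refine ⟨B.toReal, fun t ht r hr => ?_⟩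
    have ht0 : 0 ≤ t := ha.le.trans ht.1
    have hr0 : 0 < r := ha'.trans_le hr.1
    rw [ENNReal.ofReal_toReal hBtop]
    refine (lintegral_mono fun x => ENNReal.rpow_le_rpow
      (mul_le_mul' le_rfl (hosc t ht0 x)) hα0).trans ?_
    refine (lintegral_rate_add_rpow_le hlb _ hα (hφ t ht0)).trans ?_
    refine mul_le_mul' le_rfl (add_le_add (mul_le_mul' le_rfl ?_)
      (mul_le_mul' le_rfl (h t ht r ⟨hr0.le, hr.2⟩)))
    refine (lintegral_rate_jumpMarginal_le hl hl0 hlb hlbar0 hr0 hr.2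
      ((hφ t ht0).pow_const _)).trans (mul_le_mul' le_rfl ?_)
    refine (tsum_succ_div_mul_le hr0 fun n =>
      ∫⁻ x, φ t x ^ (1 + δ) ∂(jumpMarginalN l k P0 n r)).trans ?_
    exact mul_le_mul' (ENNReal.ofReal_le_ofReal (one_div_le_one_div_of_le ha' hr.1))
      (h₂ t ht r ⟨hr0.le, hr.2⟩)
  · obtain ⟨C, hC, hCb⟩ := hmoment b
    set K : ℝ≥0∞ := ENNReal.ofReal (Real.exp (lbar * b)) * (ENNReal.ofReal (Real.exp
      (2 ^ ((1 + ε) / (1 + ε - 1)) * (lbar * max 1 b))) + C) with hKdef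
    have hKtop : K ≠ ∞ := by
      rw [hKdef]
      finiteness
    have hstep : ∀ t ∈ Set.Ioc 0 b, ∫⁻ x, ENNReal.ofReal (l x) *
        ∫⁻ y, ENNReal.ofReal |ψ t y - ψ t x| ∂(k x) ∂(jumpMarginal l k P0 t) ≤
        K * ENNReal.ofReal (t ^ (-(1 / (1 + ε)))) + ENNReal.ofReal lbar * (1 + C) := by
      intro t ht
      have htI : t ∈ Set.Icc 0 b := ⟨ht.1.le, ht.2⟩
      have := isProbabilityMeasure_jumpMarginal (k := k) (P0 := P0) hl hl0 hlb hlbar0 ht.1.le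
      have hfirst : ∫⁻ x, φ t x ∂(jumpMarginal l k P0 t) ≤ 1 + C := by
        calc _ ≤ ∫⁻ x, (1 + φ t x ^ (1 + ε)) ∂(jumpMarginal l k P0 t) :=
              lintegral_mono fun x => by
                simpa using mul_rpow_le_rpow_add_rpow zero_le_one
                  (show (1 : ℝ) < 1 + ε by linarith) 1 (φ t x)
          _ = 1 + ∫⁻ x, φ t x ^ (1 + ε) ∂(jumpMarginal l k P0 t) := by
              rw [lintegral_add_left measurable_const]
              simp
          _ ≤ _ := add_le_add_right (hCb t htI) _
      calc _ ≤ ∫⁻ x, (ENNReal.ofReal (l x) * ∫⁻ y, φ t y ∂(k x) + ENNReal.ofReal lbar * φ t x)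
            ∂(jumpMarginal l k P0 t) := by
            refine lintegral_mono fun x => (mul_le_mul' le_rfl (hosc t ht.1.le x)).trans ?_
            rw [mul_add]
            exact add_le_add_right (mul_le_mul' (ENNReal.ofReal_le_ofReal (hlb x)) le_rfl) _
        _ = ∫⁻ x, ENNReal.ofReal (l x) * ∫⁻ y, φ t y ∂(k x) ∂(jumpMarginal l k P0 t) +
            ENNReal.ofReal lbar * ∫⁻ x, φ t x ∂(jumpMarginal l k P0 t) := by
            rw [lintegral_add_right _ ((hφ t ht.1.le).const_mul _),
              lintegral_const_mul' _ _ (by finiteness)]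
        _ ≤ _ := by
            refine add_le_add ?_ (mul_le_mul' le_rfl hfirst)
            refine (lintegral_rate_jumpMarginal_le hl hl0 hlb hlbar0 ht.1 ht.2
              (hφ t ht.1.le)).trans ?_
            rw [hKdef, mul_assoc, mul_comm (_ + C)]
            refine mul_le_mul' le_rfl ((tsum_succ_div_mul_lintegral_le hl hl0 hlb hlbar0
              (show (1 : ℝ) < 1 + ε by linarith) ht.1 ht.2 (φ t)).trans ?_)
            exact mul_le_mul' le_rfl (add_le_add_right (hCb t htI) _)
    rw [← setLIntegral_congr Ioc_ae_eq_Icc]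
    refine (setLIntegral_mono' measurableSet_Ioc hstep).trans_lt ?_
    rw [lintegral_add_right _ measurable_const, lintegral_const_mul' _ _ hKtop,
      setLIntegral_const]
    have hexp : -1 < -(1 / (1 + ε)) := by
      rw [neg_lt_neg_iff, div_lt_one (by linarith)]
      linarith
    have hinteg : ∫⁻ t in Set.Ioc 0 b, ENNReal.ofReal (t ^ (-(1 / (1 + ε)))) < ∞ :=
      (intervalIntegral.intervalIntegrable_rpow' (a := 0) (b := b) hexp).1.lintegral_lt_top
    rw [Real.volume_Ioc]
    exact ENNReal.add_lt_top.2 ⟨ENNReal.mul_lt_top hKtop.lt_top hinteg, by finiteness⟩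
end
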